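/- arXiv:1905.05459 — 4 statements merged into one kernel-verified Lean document; each statement's English description precedes it below -/
import Mathlib

section
/- Let α ∈ (1,2), and for parameters (α,β,σ,v) let g(·;α,β,σ,v) denote the stable density, i.e. the continuous integrable function whose Fourier transform is ∫_ℝ e^{ikx} g(x;α,β,σ,v) dx = exp(ivk − σ^α|k|^α(1 − iβ·sign(k)·tan(απ/2))). Then for all x > 0 and t > 0: g(x; α, −1, (|cos(απ/2)|·t)^{1/α}, 0) = t·x^{−1−α}·g(t·x^{−α}; 1/α, 1, |cos(π/(2α))|^α, 0). -/
open MeasureTheory Set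

/-- The characteristic function (Fourier transform) of the stable density with
parameters `(α, β, σ, v)`:
`exp(ivk − σ^α |k|^α (1 − iβ sign(k) tan(απ/2)))`. -/
noncomputable def stableCF (α β σ v : ℝ) (k : ℝ) : ℂ :=
  Complex.exp (Complex.I * (v : ℂ) * (k : ℂ) -
    ((σ ^ α * |k| ^ α : ℝ) : ℂ) *
      (1 - Complex.I * (β : ℂ) * ((Real.sign k : ℝ) : ℂ) * ((Real.tan (α * Real.pi / 2) : ℝ) : ℂ)))

/-- `g` is the stable density with parameters `(α, β, σ, v)`: a continuous integrable
function whose Fourier transform is `stableCF α β σ v`. -/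
def IsStableDensity (α β σ v : ℝ) (g : ℝ → ℝ) : Prop :=
  Continuous g ∧ MeasureTheory.Integrable g ∧
    ∀ k : ℝ, (∫ x : ℝ, Complex.exp (Complex.I * (k : ℂ) * (x : ℂ)) * (g x : ℂ)) = stableCF α β σ v k


open Complex in
lemma zd_norm_stableCF (a β σ k : ℝ) :
    ‖stableCF a β σ 0 k‖ = Real.exp (-(σ ^ a) * |k| ^ a) := by
  rw [stableCF, Complex.norm_exp]
  generalize Real.tan (a * Real.pi / 2) = T
  simp

lemma zd_stableCF_neg (a β σ k : ℝ) :
    stableCF a β σ 0 (-k) = (starRingEnd ℂ) (stableCF a β σ 0 k) := by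
  have : Real.sign (-k) = - Real.sign k := by
    rcases lt_trichotomy k 0 with h | h | h
    · rw [Real.sign_of_neg h, Real.sign_of_pos (by linarith)]; simp
    · simp [h]
    · rw [Real.sign_of_pos h, Real.sign_of_neg (by linarith)]
  rw [stableCF, stableCF, ← Complex.exp_conj, this]
  congr 1
  generalize Real.tan (a * Real.pi / 2) = T
  simp [Complex.conj_ofReal]

lemma zd_integrable_stableCF (a β σ : ℝ) (ha : 0 < a) (hσ : 0 < σ) :
    Integrable (stableCF a β σ 0) := by
  have hs : Measurable Real.sign := by
    unfold Real.sign
    exact Measurable.ite measurableSet_Iio measurable_const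
      (Measurable.ite measurableSet_Ioi measurable_const measurable_const)
  have hm : Measurable (stableCF a β σ 0) := by
    unfold stableCF
    fun_prop
  have h1 : IntegrableOn (stableCF a β σ 0) (Ioi 0) := by
    have := integrableOn_rpow_mul_exp_neg_mul_rpow (p := a) (s := 0) (b := σ ^ a) (by norm_num) ha
      (by positivity)
    refine Integrable.mono' this hm.aestronglyMeasurable ?_
    refine (ae_restrict_iff' measurableSet_Ioi).2 (Filter.Eventually.of_forall fun k hk => ?_)
    rw [zd_norm_stableCF, abs_of_pos hk]
    simp
  have h2 : IntegrableOn (stableCF a β σ 0) (Iio 0) := by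
    have h3 : IntegrableOn (fun k => stableCF a β σ 0 (-k)) (Ioi 0) := by
      simp_rw [zd_stableCF_neg]
      refine Integrable.mono h1 ?_ ?_
      · exact (Complex.continuous_conj.measurable.comp hm).aestronglyMeasurable
      · simp
    have h4 : IntegrableOn (fun k => stableCF a β σ 0 (-k)) (Ioi (-(0:ℝ))) := by
      rw [neg_zero]; exact h3
    simpa using h4.comp_neg_Iio
  have h2' : IntegrableOn (stableCF a β σ 0) (Iic 0) :=
    (integrableOn_Iic_iff_integrableOn_Iio (by finiteness)).2 h2
  have := h2'.union h1
  rwa [Iic_union_Ioi, integrableOn_univ] at this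

open FourierTransform in
lemma zd_inversion (a β σ : ℝ) (ha : 0 < a) (hσ : 0 < σ) (g : ℝ → ℝ)
    (h : IsStableDensity a β σ 0 g) (x : ℝ) :
    g x = (1 / Real.pi) * (∫ k in Ioi (0:ℝ),
      Complex.exp (-(Complex.I * k * x)) * stableCF a β σ 0 k).re := by
  obtain ⟨hc, hi, hf⟩ := h
  have hφ := zd_integrable_stableCF a β σ ha hσ
  have hF : (𝓕 (fun x => (g x : ℂ)) : ℝ → ℂ) = fun w => stableCF a β σ 0 (-2 * Real.pi * w) := by
    ext w
    rw [Real.fourier_eq', ← hf]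
    congr 1
    ext v
    rw [smul_eq_mul]
    congr 2
    simp
    ring
  have hpi := Real.pi_pos
  have hFi : Integrable (𝓕 (fun x => (g x : ℂ)) : ℝ → ℂ) := by
    rw [hF]
    exact hφ.comp_mul_left' (by nlinarith : -2 * Real.pi ≠ 0)
  have hinv : 𝓕⁻ (𝓕 (fun x => (g x : ℂ)) : ℝ → ℂ) x = g x := (hi.ofReal (𝕜 := ℂ)).fourierInv_fourier_eq hFi
    (v := x) (Complex.continuous_ofReal.comp hc).continuousAt
  have hinv' : ∫ k : ℝ, Complex.exp (-(Complex.I * k * x)) * stableCF a β σ 0 k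
      = (2 * Real.pi : ℝ) * g x := by
    rw [show (𝓕 (fun x => ((g x : ℝ) : ℂ)) : ℝ → ℂ) = _ from hF] at hinv
    rw [Real.fourierInv_eq'] at hinv
    have := Measure.integral_comp_mul_left
      (fun k : ℝ => Complex.exp (-(Complex.I * k * x)) * stableCF a β σ 0 k) (-2 * Real.pi)
    have e : (∫ v : ℝ, Complex.exp (((2 * Real.pi * inner ℝ v x : ℝ) : ℂ) * Complex.I) •
        stableCF a β σ 0 (-2 * Real.pi * v)) =
        ∫ v : ℝ, (fun k : ℝ => Complex.exp (-(Complex.I * k * x)) * stableCF a β σ 0 k)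
          (-2 * Real.pi * v) := by
      congr 1
      ext v
      rw [smul_eq_mul]
      congr 2
      simp
      ring
    rw [e, this] at hinv
    rw [show |(-2 * Real.pi)⁻¹| = (2 * Real.pi)⁻¹ by
      rw [neg_mul, inv_neg, abs_neg, abs_of_pos (by positivity)]] at hinv
    rw [show (g x : ℂ) = _ from hinv.symm, Complex.real_smul]
    rw [← mul_assoc, ← Complex.ofReal_mul, mul_inv_cancel₀ (by positivity)]
    simp
  have hGi : Integrable (fun k : ℝ => Complex.exp (-(Complex.I * k * x)) * stableCF a β σ 0 k) := by
    refine hφ.bdd_mul (c := 1) ?_ ?_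
    · exact (by fun_prop : Continuous fun k : ℝ => Complex.exp (-(Complex.I * k * x))).aestronglyMeasurable
    · refine Filter.Eventually.of_forall fun k => ?_
      rw [Complex.norm_exp]; simp
  have hsplit := integral_add_compl (measurableSet_Ioi (a := (0:ℝ))) hGi
  have hneg := integral_comp_neg_Ioi 0
    (fun k : ℝ => Complex.exp (-(Complex.I * k * x)) * stableCF a β σ 0 k)
  have hconj : (∫ k in Ioi (0:ℝ), (fun k : ℝ =>
      Complex.exp (-(Complex.I * k * x)) * stableCF a β σ 0 k) (-k)) =
      (starRingEnd ℂ) (∫ k in Ioi (0:ℝ),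
        Complex.exp (-(Complex.I * k * x)) * stableCF a β σ 0 k) := by
    rw [← integral_conj]
    congr 1
    ext k
    simp only [map_mul, zd_stableCF_neg, ← Complex.exp_conj]
    simp [Complex.conj_ofReal]
  rw [neg_zero] at hneg
  rw [compl_Ioi, ← hneg, hconj, hinv', Complex.add_conj, ← Complex.ofReal_mul] at hsplit
  have := Complex.ofReal_injective hsplit
  field_simp
  linarith

/-- the integrand along the ray of argument `θ` -/
noncomputable def zdE (α x t θ ρ : ℝ) : ℂ :=
  Complex.exp (-((x * ρ : ℝ) : ℂ) * Complex.exp ((θ : ℂ) * Complex.I)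
    + ((t * ρ ^ α : ℝ) : ℂ) * Complex.exp (((α * θ : ℝ) : ℂ) * Complex.I))

lemma zd_norm (α x t θ ρ : ℝ) :
    ‖zdE α x t θ ρ‖ = Real.exp (-(x * ρ) * Real.cos θ + t * ρ ^ α * Real.cos (α * θ)) := by
  rw [zdE, Complex.norm_exp, Complex.add_re, ← Complex.ofReal_neg, Complex.re_ofReal_mul,
    Complex.re_ofReal_mul, Complex.exp_ofReal_mul_I_re, Complex.exp_ofReal_mul_I_re]

lemma zd_bound (α x t : ℝ) (h1 : 1 < α) (h2 : α < 2) (hx : 0 < x) (ht : 0 < t) :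
    ∃ c > 0, ∀ θ ∈ Icc (Real.pi / (2 * α)) (Real.pi / 2), ∀ ρ : ℝ, 0 ≤ ρ →
      ‖zdE α x t θ ρ‖ ≤ Real.exp c * Real.exp (-c * ρ) := by
  have hpi := Real.pi_pos
  have hle : Real.pi / (2 * α) ≤ Real.pi / 2 := by
    apply div_le_div_of_nonneg_left <;> linarith
  have hsgn : ∀ θ ∈ Icc (Real.pi / (2 * α)) (Real.pi / 2),
      0 ≤ Real.cos θ ∧ Real.cos (α * θ) ≤ 0 ∧ (Real.cos θ = 0 → Real.cos (α * θ) < 0) := by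
    intro θ hθ
    have h0 : 0 < Real.pi / (2 * α) := by positivity
    have h3 : Real.pi / 2 ≤ α * θ := by
      have := mul_le_mul_of_nonneg_left hθ.1 (by linarith : 0 ≤ α)
      have e : α * (Real.pi / (2 * α)) = Real.pi / 2 := by field_simp
      linarith
    have h4 : α * θ ≤ Real.pi := by nlinarith [hθ.2, hθ.1]
    refine ⟨Real.cos_nonneg_of_neg_pi_div_two_le_of_le (by linarith [hθ.1]) hθ.2,
      Real.cos_nonpos_of_pi_div_two_le_of_le h3 (by linarith), fun hz => ?_⟩
    have : ¬ θ < Real.pi / 2 := fun hl =>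
      (Real.cos_pos_of_mem_Ioo ⟨by linarith [hθ.1], hl⟩).ne' hz
    have : θ = Real.pi / 2 := le_antisymm hθ.2 (not_lt.1 this)
    apply Real.cos_neg_of_pi_div_two_lt_of_lt
    · rw [this]; nlinarith
    · linarith
  obtain ⟨θ₀, hθ₀, hmin⟩ := isCompact_Icc.exists_isMinOn (nonempty_Icc.2 hle)
    (f := fun θ => x * Real.cos θ - t * Real.cos (α * θ)) (by fun_prop)
  refine ⟨x * Real.cos θ₀ - t * Real.cos (α * θ₀), ?_, ?_⟩
  · obtain ⟨a, b, d⟩ := hsgn θ₀ hθ₀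
    rcases a.eq_or_lt with e | e
    · have := d e.symm
      rw [← e]; nlinarith
    · nlinarith [mul_pos hx e]
  · intro θ hθ ρ hρ
    have hm : x * Real.cos θ₀ - t * Real.cos (α * θ₀) ≤ x * Real.cos θ - t * Real.cos (α * θ) :=
      hmin hθ
    obtain ⟨a, b, -⟩ := hsgn θ hθ
    obtain ⟨a', b', -⟩ := hsgn θ₀ hθ₀
    rw [zd_norm, ← Real.exp_add, Real.exp_le_exp]
    set c := x * Real.cos θ₀ - t * Real.cos (α * θ₀)
    have hc : 0 ≤ c := by
      have := mul_nonneg hx.le a'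
      have := mul_nonneg ht.le (neg_nonneg.2 b')
      simp only [c]; linarith
    have hA := mul_nonneg hx.le a
    have hB := mul_nonneg ht.le (neg_nonneg.2 b)
    have hr : 0 ≤ ρ ^ α := Real.rpow_nonneg hρ α
    rcases le_total 1 ρ with h | h
    · have hp : ρ ≤ ρ ^ α := by
        simpa using Real.rpow_le_rpow_of_exponent_le h h1.le
      nlinarith [mul_nonneg hB (sub_nonneg.2 hp), mul_nonneg hρ (sub_nonneg.2 hm)]
    · nlinarith [mul_nonneg hA hρ, mul_nonneg hB hr, mul_nonneg hc (sub_nonneg.2 h)]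

lemma zd_cont (α x t θ : ℝ) (h1 : 1 < α) : Continuous (zdE α x t θ) := by
  unfold zdE
  have : Continuous fun ρ : ℝ => ρ ^ α := Real.continuous_rpow_const (by linarith)
  fun_prop

lemma zd_int_bound (s c : ℝ) (hs : 0 ≤ s) (hc : 0 < c) :
    IntegrableOn (fun ρ : ℝ => ρ ^ s * (Real.exp c * Real.exp (-c * ρ))) (Ioi 0) := by
  have := (integrableOn_rpow_mul_exp_neg_mul_rpow (p := 1) (s := s) (b := c) (by linarith)
    one_pos hc).const_mul (Real.exp c)
  refine this.congr (Filter.Eventually.of_forall fun ρ => ?_)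
  simp only [Real.rpow_one]
  ring

lemma zd_deriv_rho (α x t θ ρ : ℝ) (h1 : 1 < α) :
    HasDerivAt (zdE α x t θ) (zdE α x t θ ρ *
      (-(x : ℂ) * Complex.exp ((θ : ℂ) * Complex.I)
        + ((t * (α * ρ ^ (α - 1)) : ℝ) : ℂ) * Complex.exp (((α * θ : ℝ) : ℂ) * Complex.I))) ρ := by
  unfold zdE
  apply HasDerivAt.cexp
  have e1 : HasDerivAt (fun ρ : ℝ => ((x * ρ : ℝ) : ℂ)) (x : ℂ) ρ := by
    simpa using ((hasDerivAt_id ρ).const_mul x).ofReal_comp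
  have e2 : HasDerivAt (fun ρ : ℝ => ((t * ρ ^ α : ℝ) : ℂ)) ((t * (α * ρ ^ (α - 1)) : ℝ) : ℂ) ρ :=
    ((Real.hasDerivAt_rpow_const (Or.inr h1.le)).const_mul t).ofReal_comp
  exact (e1.neg.mul_const _).add (e2.mul_const _)

lemma zd_deriv_theta (α x t θ ρ : ℝ) :
    HasDerivAt (fun θ => zdE α x t θ ρ * Complex.exp ((θ : ℂ) * Complex.I))
      (zdE α x t θ ρ * (-((x * ρ : ℝ) : ℂ) * (Complex.exp ((θ : ℂ) * Complex.I) * Complex.I)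
        + ((t * ρ ^ α : ℝ) : ℂ) *
          (Complex.exp (((α * θ : ℝ) : ℂ) * Complex.I) * ((α : ℂ) * Complex.I)))
        * Complex.exp ((θ : ℂ) * Complex.I)
      + zdE α x t θ ρ * (Complex.exp ((θ : ℂ) * Complex.I) * Complex.I)) θ := by
  have e1 : HasDerivAt (fun θ : ℝ => Complex.exp ((θ : ℂ) * Complex.I))
      (Complex.exp ((θ : ℂ) * Complex.I) * Complex.I) θ := by
    apply HasDerivAt.cexp
    simpa using ((hasDerivAt_id θ).ofReal_comp).mul_const Complex.I
  have e2 : HasDerivAt (fun θ : ℝ => Complex.exp (((α * θ : ℝ) : ℂ) * Complex.I))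
      (Complex.exp (((α * θ : ℝ) : ℂ) * Complex.I) * ((α : ℂ) * Complex.I)) θ := by
    apply HasDerivAt.cexp
    simpa using (((hasDerivAt_id θ).const_mul α).ofReal_comp).mul_const Complex.I
  refine HasDerivAt.mul ?_ e1
  unfold zdE
  apply HasDerivAt.cexp
  exact (e1.const_mul _).add (e2.const_mul _)

lemma zd_tendsto (s c : ℝ) (hc : 0 < c) :
    Filter.Tendsto (fun ρ : ℝ => ρ ^ s * (Real.exp c * Real.exp (-c * ρ))) Filter.atTop (nhds 0) := by
  have := (tendsto_rpow_mul_exp_neg_mul_atTop_nhds_zero s c hc).const_mul (Real.exp c)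
  rw [mul_zero] at this
  refine this.congr fun ρ => ?_
  ring

/-- rotation of the contour -/
lemma zd_rotate (α x t : ℝ) (h1 : 1 < α) (h2 : α < 2) (hx : 0 < x) (ht : 0 < t) :
    (∫ ρ in Ioi (0:ℝ), zdE α x t (Real.pi / 2) ρ
        * Complex.exp (((Real.pi / 2 : ℝ) : ℂ) * Complex.I)) =
    ∫ ρ in Ioi (0:ℝ), zdE α x t (Real.pi / (2 * α)) ρ
        * Complex.exp (((Real.pi / (2 * α) : ℝ) : ℂ) * Complex.I) := by
  obtain ⟨c, hc, hb⟩ := zd_bound α x t h1 h2 hx ht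
  have hpi := Real.pi_pos
  have hle : Real.pi / (2 * α) ≤ Real.pi / 2 := by
    apply div_le_div_of_nonneg_left <;> linarith
  have hcr : Continuous fun ρ : ℝ => ρ ^ α := Real.continuous_rpow_const (by linarith)
  have hcr1 : Continuous fun ρ : ℝ => ρ ^ (α - 1) := Real.continuous_rpow_const (by linarith)
  have hcE := fun θ => zd_cont α x t θ h1
  set F : ℝ → ℝ → ℂ := fun θ ρ => zdE α x t θ ρ * Complex.exp ((θ : ℂ) * Complex.I) with hF
  set F' : ℝ → ℝ → ℂ := fun θ ρ =>
      (zdE α x t θ ρ * (-((x * ρ : ℝ) : ℂ) * (Complex.exp ((θ : ℂ) * Complex.I) * Complex.I)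
        + ((t * ρ ^ α : ℝ) : ℂ) *
          (Complex.exp (((α * θ : ℝ) : ℂ) * Complex.I) * ((α : ℂ) * Complex.I)))
        * Complex.exp ((θ : ℂ) * Complex.I)
      + zdE α x t θ ρ * (Complex.exp ((θ : ℂ) * Complex.I) * Complex.I)) with hF'
  have hFc : ∀ θ, Continuous (F θ) := fun θ => by
    have := hcE θ
    simp only [hF]; fun_prop
  have hF'c : ∀ θ, Continuous (F' θ) := fun θ => by
    have := hcE θ
    simp only [hF']; fun_prop
  have hI0 : IntegrableOn (fun ρ : ℝ => Real.exp c * Real.exp (-c * ρ)) (Ioi 0) := by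
    simpa using zd_int_bound 0 c le_rfl hc
  have hI1 := zd_int_bound 1 c zero_le_one hc
  have hIα := zd_int_bound α c (by linarith) hc
  have hbF : ∀ θ ∈ Icc (Real.pi / (2 * α)) (Real.pi / 2), ∀ᵐ ρ ∂(volume.restrict (Ioi (0:ℝ))),
      ‖F θ ρ‖ ≤ Real.exp c * Real.exp (-c * ρ) := by
    intro θ hθ
    refine (ae_restrict_iff' measurableSet_Ioi).2 (Filter.Eventually.of_forall fun ρ hρ => ?_)
    simp only [hF]
    rw [norm_mul, Complex.norm_exp_ofReal_mul_I, mul_one]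
    exact hb θ hθ ρ (le_of_lt hρ)
  have hcont : ContinuousOn (fun θ => ∫ ρ in Ioi (0:ℝ), F θ ρ)
      (Icc (Real.pi / (2 * α)) (Real.pi / 2)) := by
    refine continuousOn_of_dominated (fun θ _ => (hFc θ).aestronglyMeasurable) hbF hI0 ?_
    refine Filter.Eventually.of_forall fun ρ θ _ => ?_
    exact (zd_deriv_theta α x t θ ρ).continuousAt.continuousWithinAt
  have hder : ∀ θ ∈ Ioo (Real.pi / (2 * α)) (Real.pi / 2),
      HasDerivAt (fun θ => ∫ ρ in Ioi (0:ℝ), F θ ρ) 0 θ := by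
    intro θ hθ
    have key := hasDerivAt_integral_of_dominated_loc_of_deriv_le
      (μ := volume.restrict (Ioi (0:ℝ))) (F := F) (F' := F') (x₀ := θ)
      (s := Ioo (Real.pi / (2 * α)) (Real.pi / 2))
      (bound := fun ρ => x * (ρ ^ (1:ℝ) * (Real.exp c * Real.exp (-c * ρ)))
        + t * α * (ρ ^ α * (Real.exp c * Real.exp (-c * ρ))) + Real.exp c * Real.exp (-c * ρ))
      (Ioo_mem_nhds hθ.1 hθ.2)
      (Filter.Eventually.of_forall fun θ => (hFc θ).aestronglyMeasurable)
      (Integrable.mono' hI0 (hFc θ).aestronglyMeasurable (hbF θ (Ioo_subset_Icc_self hθ)))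
      (hF'c θ).aestronglyMeasurable ?_ (((hI1.const_mul x).add (hIα.const_mul (t * α))).add hI0)
      (Filter.Eventually.of_forall fun ρ θ _ => zd_deriv_theta α x t θ ρ)
    · obtain ⟨hFint, hd⟩ := key
      suffices h0 : ∫ ρ in Ioi (0:ℝ), F' θ ρ = 0 by rwa [h0] at hd
      have hH := integral_Ioi_of_hasDerivAt_of_tendsto' (a := (0:ℝ)) (m := (0:ℂ))
        (f := fun ρ : ℝ => (ρ : ℂ) * zdE α x t θ ρ *
          (Complex.exp ((θ : ℂ) * Complex.I) * Complex.I)) (f' := F' θ) ?_ hFint ?_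
      · rw [hH]; simp
      · intro ρ hρ
        have hρ0 : (0:ℝ) ≤ ρ := hρ
        have e := (((hasDerivAt_id ρ).ofReal_comp).mul (zd_deriv_rho α x t θ ρ h1)).mul_const
          (Complex.exp ((θ : ℂ) * Complex.I) * Complex.I)
        refine e.congr_deriv ?_
        have hpw : ρ ^ α = ρ * ρ ^ (α - 1) := by
          rcases hρ0.eq_or_lt with e0 | e0
          · rw [← e0, Real.zero_rpow (by linarith), zero_mul]
          · rw [Real.rpow_sub_one e0.ne']; field_simp
        simp only [hF', hpw]
        push_cast
        simp only [id]
        ring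
      · refine squeeze_zero_norm' ?_ (zd_tendsto 1 c hc)
        filter_upwards [Filter.eventually_ge_atTop 0] with ρ hρ
        rw [norm_mul, norm_mul, norm_mul, Complex.norm_exp_ofReal_mul_I, Complex.norm_I,
          Complex.norm_real, Real.norm_of_nonneg hρ, Real.rpow_one, mul_one, mul_one]
        exact mul_le_mul_of_nonneg_left (hb θ (Ioo_subset_Icc_self hθ) ρ hρ) hρ
    · refine (ae_restrict_iff' measurableSet_Ioi).2 (Filter.Eventually.of_forall fun ρ hρ θ hθ => ?_)
      have hρ0 : (0:ℝ) ≤ ρ := le_of_lt hρ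
      have hr : 0 ≤ ρ ^ α := Real.rpow_nonneg hρ0 α
      have hE := hb θ (Ioo_subset_Icc_self hθ) ρ hρ0
      have hα0 : 0 < α := by linarith
      simp only [hF']
      refine (norm_add_le _ _).trans ?_
      refine add_le_add ?_ ?_
      · rw [norm_mul, norm_mul, Complex.norm_exp_ofReal_mul_I, mul_one]
        refine (mul_le_mul hE (norm_add_le _ _) (norm_nonneg _) (by positivity)).trans ?_
        rw [norm_mul, norm_mul, norm_mul, norm_mul, norm_mul, Complex.norm_exp_ofReal_mul_I,
          Complex.norm_exp_ofReal_mul_I, norm_neg, Complex.norm_I,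
          Complex.norm_real, Complex.norm_real, Complex.norm_real, Real.norm_of_nonneg hα0.le,
          Real.norm_of_nonneg (by positivity : 0 ≤ x * ρ),
          Real.norm_of_nonneg (by positivity : 0 ≤ t * ρ ^ α), Real.rpow_one]
        apply le_of_eq; ring
      · rw [norm_mul, norm_mul, Complex.norm_exp_ofReal_mul_I, Complex.norm_I, mul_one, mul_one]
        exact hE
  have := intervalIntegral.integral_eq_sub_of_hasDerivAt_of_le hle hcont hder
    (by simp)
  rw [intervalIntegral.integral_zero] at this
  exact sub_eq_zero.1 this.symm

lemma zd_ftc (α x t : ℝ) (h1 : 1 < α) (h2 : α < 2) (hx : 0 < x) (ht : 0 < t) :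
    (x : ℂ) * (∫ ρ in Ioi (0:ℝ), zdE α x t (Real.pi / (2 * α)) ρ
        * Complex.exp (((Real.pi / (2 * α) : ℝ) : ℂ) * Complex.I)) =
    1 + (t : ℂ) * (∫ ρ in Ioi (0:ℝ), ((α * ρ ^ (α - 1) : ℝ) : ℂ) *
      (zdE α x t (Real.pi / (2 * α)) ρ * Complex.I)) := by
  obtain ⟨c, hc, hb⟩ := zd_bound α x t h1 h2 hx ht
  have hpi := Real.pi_pos
  have hle : Real.pi / (2 * α) ≤ Real.pi / 2 := by
    apply div_le_div_of_nonneg_left <;> linarith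
  have hcr1 : Continuous fun ρ : ℝ => ρ ^ (α - 1) := Real.continuous_rpow_const (by linarith)
  set θ := Real.pi / (2 * α) with hθ
  have hcE := zd_cont α x t θ h1
  replace hb := hb θ (left_mem_Icc.2 hle)
  have hαθ : Complex.exp (((α * θ : ℝ) : ℂ) * Complex.I) = Complex.I := by
    rw [show α * θ = Real.pi / 2 by rw [hθ]; field_simp]
    push_cast
    exact Complex.exp_pi_div_two_mul_I
  have hI0 : IntegrableOn (fun ρ : ℝ => Real.exp c * Real.exp (-c * ρ)) (Ioi 0) := by
    simpa using zd_int_bound 0 c le_rfl hc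
  have hI1 := zd_int_bound (α - 1) c (by linarith) hc
  have i1 : IntegrableOn (fun ρ => zdE α x t θ ρ * Complex.exp ((θ : ℂ) * Complex.I)) (Ioi 0) := by
    refine Integrable.mono' hI0 (by fun_prop) ?_
    refine (ae_restrict_iff' measurableSet_Ioi).2 (Filter.Eventually.of_forall fun ρ hρ => ?_)
    rw [norm_mul, Complex.norm_exp_ofReal_mul_I, mul_one]
    exact hb ρ (le_of_lt hρ)
  have i2 : IntegrableOn (fun ρ : ℝ => ((α * ρ ^ (α - 1) : ℝ) : ℂ) *
      (zdE α x t θ ρ * Complex.I)) (Ioi 0) := by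
    refine Integrable.mono' (hI1.const_mul α)
      (by fun_prop : Continuous _).aestronglyMeasurable ?_
    refine (ae_restrict_iff' measurableSet_Ioi).2 (Filter.Eventually.of_forall fun ρ hρ => ?_)
    have hρ0 : (0:ℝ) ≤ ρ := le_of_lt hρ
    have hα0 : 0 < α := by linarith
    rw [norm_mul, norm_mul, Complex.norm_I, mul_one, Complex.norm_real,
      Real.norm_of_nonneg (by positivity), mul_assoc]
    have := hb ρ hρ0
    gcongr
  have hH := integral_Ioi_of_hasDerivAt_of_tendsto' (a := (0:ℝ)) (m := (0:ℂ))
    (f := zdE α x t θ)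
    (f' := fun ρ : ℝ => (t : ℂ) * (((α * ρ ^ (α - 1) : ℝ) : ℂ) * (zdE α x t θ ρ * Complex.I))
      - (x : ℂ) * (zdE α x t θ ρ * Complex.exp ((θ : ℂ) * Complex.I))) ?_
      ((i2.const_mul _).sub (i1.const_mul _)) ?_
  · rw [integral_sub (i2.const_mul _) (i1.const_mul _), integral_const_mul, integral_const_mul] at hH
    have h0 : zdE α x t θ 0 = 1 := by
      unfold zdE
      rw [Real.zero_rpow (by linarith)]; simp
    rw [h0] at hH
    linear_combination -hH
  · intro ρ hρ
    refine (zd_deriv_rho α x t θ ρ h1).congr_deriv ?_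
    rw [hαθ]
    push_cast
    ring
  · refine squeeze_zero_norm' ?_ (zd_tendsto 0 c hc)
    filter_upwards [Filter.eventually_ge_atTop 0] with ρ hρ
    simpa using hb ρ hρ

lemma zd_left (α x t k : ℝ) (h1 : 1 < α) (h2 : α < 2) (ht : 0 < t) (hk : 0 < k) :
    Complex.exp (-(Complex.I * k * x)) *
      stableCF α (-1) ((|Real.cos (α * Real.pi / 2)| * t) ^ (1 / α)) 0 k
      = zdE α x t (Real.pi / 2) k := by
  have hpi := Real.pi_pos
  have hcos : Real.cos (α * Real.pi / 2) < 0 :=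
    Real.cos_neg_of_pi_div_two_lt_of_lt (by nlinarith) (by nlinarith)
  have hσ : ((|Real.cos (α * Real.pi / 2)| * t) ^ (1 / α)) ^ α = -Real.cos (α * Real.pi / 2) * t := by
    rw [← Real.rpow_mul (by positivity), one_div_mul_cancel (by linarith), Real.rpow_one,
      abs_of_neg hcos]
  rw [stableCF, zdE, ← Complex.exp_add, hσ, Real.sign_of_pos hk, abs_of_pos hk,
    show α * (Real.pi / 2) = α * Real.pi / 2 by ring, Real.tan_eq_sin_div_cos]
  congr 1
  have e1 : Complex.exp (((Real.pi / 2 : ℝ) : ℂ) * Complex.I) = Complex.I := by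
    push_cast
    exact Complex.exp_pi_div_two_mul_I
  rw [e1, Complex.exp_mul_I, ← Complex.ofReal_cos, ← Complex.ofReal_sin]
  generalize Real.sin (α * Real.pi / 2) = S at *
  generalize Real.cos (α * Real.pi / 2) = C at *
  have hC : (C : ℂ) ≠ 0 := by exact_mod_cast hcos.ne
  push_cast
  field_simp
  ring

lemma zd_right (α x t ρ : ℝ) (h1 : 1 < α) (hx : 0 < x) (hρ : 0 < ρ) :
    Complex.exp (-(Complex.I * (((x * ρ) ^ α : ℝ) : ℂ) * ((t * x ^ (-α) : ℝ) : ℂ))) *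
      stableCF (1 / α) 1 (|Real.cos (Real.pi / (2 * α))| ^ α) 0 ((x * ρ) ^ α)
      = (starRingEnd ℂ) (zdE α x t (Real.pi / (2 * α)) ρ) := by
  have hpi := Real.pi_pos
  have hα : 0 < α := by linarith
  have hcos : 0 < Real.cos (Real.pi / (2 * α)) := by
    apply Real.cos_pos_of_mem_Ioo
    constructor
    · have : 0 < Real.pi / (2 * α) := by positivity
      linarith
    · apply div_lt_div_of_pos_left <;> linarith
  have hσ : (|Real.cos (Real.pi / (2 * α))| ^ α) ^ (1 / α) = Real.cos (Real.pi / (2 * α)) := by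
    rw [← Real.rpow_mul (by positivity), mul_one_div_cancel hα.ne', Real.rpow_one,
      abs_of_pos hcos]
  have hp : 0 < (x * ρ) ^ α := by positivity
  have hk : ((x * ρ) ^ α) ^ (1 / α) = x * ρ := by
    rw [← Real.rpow_mul (by positivity), mul_one_div_cancel hα.ne', Real.rpow_one]
  have hy : (x * ρ) ^ α * (t * x ^ (-α)) = t * ρ ^ α := by
    rw [Real.mul_rpow hx.le hρ.le, Real.rpow_neg hx.le]
    have : x ^ α ≠ 0 := by positivity
    field_simp
  rw [stableCF, zdE, ← Complex.exp_add, hσ, Real.sign_of_pos hp, abs_of_pos hp, hk,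
    show 1 / α * Real.pi / 2 = Real.pi / (2 * α) by field_simp, Real.tan_eq_sin_div_cos,
    mul_assoc, ← Complex.ofReal_mul, hy, ← Complex.exp_conj]
  congr 1
  have e1 : Complex.exp (((α * (Real.pi / (2 * α)) : ℝ) : ℂ) * Complex.I) = Complex.I := by
    rw [show α * (Real.pi / (2 * α)) = Real.pi / 2 by field_simp]
    push_cast
    exact Complex.exp_pi_div_two_mul_I
  rw [e1, Complex.exp_mul_I, ← Complex.ofReal_cos, ← Complex.ofReal_sin]
  generalize Real.sin (Real.pi / (2 * α)) = S at *
  generalize Real.cos (Real.pi / (2 * α)) = C at *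
  have hC : (C : ℂ) ≠ 0 := by exact_mod_cast hcos.ne'
  simp only [map_add, map_mul, map_neg, Complex.conj_ofReal, Complex.conj_I]
  push_cast
  field_simp
  ring

/-- Zolotarev duality: for `α ∈ (1,2)`, `x > 0`, `t > 0`,
`g(x; α, −1, (|cos(απ/2)|t)^{1/α}, 0) = t x^{−1−α} g(t x^{−α}; 1/α, 1, |cos(π/(2α))|^α, 0)`. -/
theorem zolotarev_duality
    (α : ℝ) (hα : 1 < α ∧ α < 2)
    (g : ℝ → ℝ → ℝ → ℝ → ℝ → ℝ)
    (hg : ∀ a β σ v : ℝ, (0 < a ∧ a < 2 ∧ a ≠ 1) → (-1 ≤ β ∧ β ≤ 1) → 0 < σ →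
      IsStableDensity a β σ v (fun x => g x a β σ v))
    (x t : ℝ) (hx : 0 < x) (ht : 0 < t) :
    g x α (-1) ((|Real.cos (α * Real.pi / 2)| * t) ^ (1 / α)) 0
      = t * x ^ (-1 - α) *
        g (t * x ^ (-α)) (1 / α) 1 (|Real.cos (Real.pi / (2 * α))| ^ α) 0 := by

  obtain ⟨h1, h2⟩ := hα
  have hpi := Real.pi_pos
  have hα0 : 0 < α := by linarith
  have hcosX : Real.cos (α * Real.pi / 2) < 0 :=
    Real.cos_neg_of_pi_div_two_lt_of_lt (by nlinarith) (by nlinarith)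
  have hcosY : 0 < Real.cos (Real.pi / (2 * α)) := by
    apply Real.cos_pos_of_mem_Ioo
    constructor
    · have : 0 < Real.pi / (2 * α) := by positivity
      linarith
    · apply div_lt_div_of_pos_left <;> linarith
  have hσX : 0 < (|Real.cos (α * Real.pi / 2)| * t) ^ (1 / α) := by
    have := abs_pos.2 hcosX.ne
    positivity
  have hσY : 0 < |Real.cos (Real.pi / (2 * α))| ^ α := by
    have := abs_pos.2 hcosY.ne'
    positivity
  have hX := zd_inversion α (-1) _ hα0 hσX _ (hg α (-1) _ 0 ⟨hα0, h2, h1.ne'⟩ (by norm_num) hσX) x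
  have ha1 : 1 / α < 1 := by rw [div_lt_one hα0]; exact h1
  have hY := zd_inversion (1 / α) 1 _ (by positivity) hσY _
    (hg (1 / α) 1 _ 0 ⟨by positivity, by linarith, ha1.ne⟩ (by norm_num) hσY) (t * x ^ (-α))
  have eX := setIntegral_congr_fun (μ := volume) (measurableSet_Ioi (a := (0:ℝ)))
    (fun k hk => zd_left α x t k h1 h2 ht hk)
  have eI : (∫ ρ in Ioi (0:ℝ), zdE α x t (Real.pi / 2) ρ
        * Complex.exp (((Real.pi / 2 : ℝ) : ℂ) * Complex.I)) =
      (∫ ρ in Ioi (0:ℝ), zdE α x t (Real.pi / 2) ρ) * Complex.I := by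
    rw [integral_mul_const]
    congr 1
    push_cast
    exact Complex.exp_pi_div_two_mul_I
  have hrot := zd_rotate α x t h1 h2 hx ht
  have hftc := zd_ftc α x t h1 h2 hx ht
  rw [← hrot, eI] at hftc
  set J := ∫ ρ in Ioi (0:ℝ), ((α * ρ ^ (α - 1) : ℝ) : ℂ) * zdE α x t (Real.pi / (2 * α)) ρ with hJ
  have eJ : (∫ ρ in Ioi (0:ℝ), ((α * ρ ^ (α - 1) : ℝ) : ℂ) *
      (zdE α x t (Real.pi / (2 * α)) ρ * Complex.I)) = J * Complex.I := by
    rw [hJ, ← integral_mul_const]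
    simp_rw [mul_assoc]
  rw [eJ] at hftc
  have him := congrArg Complex.im hftc
  have eY : (∫ k in Ioi (0:ℝ), Complex.exp (-(Complex.I * k * ((t * x ^ (-α) : ℝ) : ℂ))) *
      stableCF (1 / α) 1 (|Real.cos (Real.pi / (2 * α))| ^ α) 0 k)
      = ((x ^ α : ℝ) : ℂ) * (starRingEnd ℂ) J := by
    rw [← integral_comp_rpow_Ioi_of_pos hα0]
    have := integral_comp_mul_left_Ioi' (fun r : ℝ => (α * r ^ (α - 1)) •
      (Complex.exp (-(Complex.I * ((r ^ α : ℝ) : ℂ) * ((t * x ^ (-α) : ℝ) : ℂ))) *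
      stableCF (1 / α) 1 (|Real.cos (Real.pi / (2 * α))| ^ α) 0 (r ^ α))) 0 hx
    rw [mul_zero] at this
    rw [← this, hJ, ← integral_conj, ← integral_const_mul, ← integral_smul]
    refine setIntegral_congr_fun measurableSet_Ioi fun ρ hρ => ?_
    have hρ0 : 0 < ρ := hρ
    rw [zd_right α x t ρ h1 hx hρ0, map_mul, Complex.conj_ofReal, Complex.real_smul,
      Complex.real_smul, ← mul_assoc, ← mul_assoc, ← Complex.ofReal_mul, ← Complex.ofReal_mul]
    congr 2
    rw [Real.mul_rpow hx.le hρ0.le, Real.rpow_sub_one hx.ne']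
    field_simp
  rw [eX] at hX
  rw [eY] at hY
  rw [hX, hY]
  rw [Complex.re_ofReal_mul, Complex.conj_re]
  simp only [Complex.im_ofReal_mul, Complex.add_im, Complex.one_im,
    Complex.mul_I_im, zero_add] at him
  have e : x ^ (-1 - α) = (x * x ^ α)⁻¹ := by
    rw [show -1 - α = -(1 + α) by ring, Real.rpow_neg hx.le, Real.rpow_add hx, Real.rpow_one]
  rw [e]
  have : x ^ α ≠ 0 := by positivity
  field_simp
  linarith
end

section
/- Let α ∈ (1,2) and define h(x,t) = α·t·x^{−1−α}·g(t·x^{−α}; 1/α, 1, |cos(π/(2α))|^α, 0) for x > 0, t > 0, where g denotes the stable density. Then h solves the time-fractional partial differential equation of order 1/α: for all x > 0 and t > 0, (1/Γ(1 − 1/α))·∫_0^t (t−u)^{−1/α}·(∂h/∂u)(x,u) du = −(∂h/∂x)(x,t), where the left-hand side is the Caputo fractional derivative of order 1/α of t ↦ h(x,t). -/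
open MeasureTheory Set

/-- The Laplace transform `exp(-s^a)`. -/
noncomputable def phiL (a : ℝ) (s : ℂ) : ℂ := Complex.exp (-(s ^ (a : ℂ)))

lemma re_cpow_lower {a : ℝ} (ha : 0 < a) (ha1 : a < 1) {s : ℂ} (hs : 0 ≤ s.re) :
    Real.cos (Real.pi / 2 * a) * ‖s‖ ^ a ≤ (s ^ (a : ℂ)).re := by
  rw [Complex.cpow_ofReal_re, mul_comm]
  refine mul_le_mul_of_nonneg_left ?_ (by positivity)
  have h1 := Complex.abs_arg_le_pi_div_two_iff.2 hs
  rw [← Real.cos_abs (s.arg * a), abs_mul, abs_of_pos ha]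
  apply Real.cos_le_cos_of_nonneg_of_le_pi (by positivity)
  · nlinarith [Real.pi_pos]
  · exact mul_le_mul_of_nonneg_right h1 ha.le

lemma kappa_pos {a : ℝ} (ha : 0 < a) (ha1 : a < 1) : 0 < Real.cos (Real.pi / 2 * a) := by
  apply Real.cos_pos_of_mem_Ioo
  constructor <;> nlinarith [Real.pi_pos]

lemma norm_phiL_le {a : ℝ} (ha : 0 < a) (ha1 : a < 1) {s : ℂ} (hs : 0 ≤ s.re) :
    ‖phiL a s‖ ≤ Real.exp (-(Real.cos (Real.pi / 2 * a) * ‖s‖ ^ a)) := by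
  rw [phiL, Complex.norm_exp]
  apply Real.exp_le_exp.2
  have := re_cpow_lower ha ha1 hs
  simp only [Complex.neg_re]
  linarith

lemma norm_phiL_le_one {a : ℝ} (ha : 0 < a) (ha1 : a < 1) {s : ℂ} (hs : 0 ≤ s.re) :
    ‖phiL a s‖ ≤ 1 := by
  refine (norm_phiL_le ha ha1 hs).trans ?_
  rw [Real.exp_le_one_iff]
  have := kappa_pos ha ha1
  have : 0 ≤ ‖s‖ ^ a := by positivity
  nlinarith

/-- polynomial decay away from the unit disc -/
lemma norm_phiL_decay {a : ℝ} (ha : 1 / 2 < a) (ha1 : a < 1) :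
    ∃ C : ℝ, 0 < C ∧ ∀ s : ℂ, 0 ≤ s.re → 1 ≤ ‖s‖ → ‖phiL a s‖ ≤ C * (‖s‖ ^ 4)⁻¹ := by
  have ha0 : 0 < a := by linarith
  have hk := kappa_pos ha0 ha1
  set κ := Real.cos (Real.pi / 2 * a) with hκ
  refine ⟨(Nat.factorial 8 : ℝ) / κ ^ 8, by positivity, fun s hs h1 => ?_⟩
  refine (norm_phiL_le ha0 ha1 hs).trans ?_
  have h2 : ‖s‖ ^ 4 ≤ (‖s‖ ^ a) ^ 8 := by
    rw [← Real.rpow_natCast (‖s‖ ^ a), ← Real.rpow_natCast ‖s‖, ← Real.rpow_mul (by positivity)]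
    apply Real.rpow_le_rpow_of_exponent_le h1
    push_cast; linarith
  have h3 := Real.pow_div_factorial_le_exp (κ * ‖s‖ ^ a) (by positivity) 8
  rw [Real.exp_neg]
  have h4 : κ ^ 8 * ‖s‖ ^ 4 / (Nat.factorial 8 : ℝ) ≤ Real.exp (κ * ‖s‖ ^ a) := by
    refine le_trans ?_ h3
    rw [mul_pow]
    gcongr
  have hpos : 0 < κ ^ 8 * ‖s‖ ^ 4 / (Nat.factorial 8 : ℝ) := by positivity
  refine (inv_anti₀ hpos h4).trans (le_of_eq ?_)
  field_simp

lemma norm_phiL_decay2 {a : ℝ} (ha : 1 / 2 < a) (ha1 : a < 1) :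
    ∃ C : ℝ, 0 < C ∧ ∀ s : ℂ, 0 ≤ s.re → ‖phiL a s‖ ≤ C * (1 + s.im ^ 2)⁻¹ := by
  obtain ⟨C, hC, h⟩ := norm_phiL_decay ha ha1
  refine ⟨2 * (C + 1), by positivity, fun s hs => ?_⟩
  have him : s.im ^ 2 ≤ ‖s‖ ^ 2 := by
    rw [← Complex.normSq_eq_norm_sq, Complex.normSq_apply]; nlinarith [sq_nonneg s.re]
  rw [← div_eq_mul_inv, le_div_iff₀ (by positivity)]
  rcases le_total 1 ‖s‖ with h1 | h1
  · have h2 := h s hs h1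
    have h3 : 1 + s.im ^ 2 ≤ 2 * ‖s‖ ^ 4 := by nlinarith [one_le_pow₀ h1 (n := 2)]
    calc ‖phiL a s‖ * (1 + s.im ^ 2) ≤ (C * (‖s‖ ^ 4)⁻¹) * (2 * ‖s‖ ^ 4) := by gcongr
      _ = 2 * C := by field_simp
      _ ≤ _ := by linarith
  · have h2 := norm_phiL_le_one (by linarith : 0 < a) ha1 hs
    have h3 : 1 + s.im ^ 2 ≤ 2 := by nlinarith [norm_nonneg s]
    calc ‖phiL a s‖ * (1 + s.im ^ 2) ≤ 1 * 2 := by gcongr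
      _ ≤ _ := by linarith

lemma phiL_continuousAt {a : ℝ} (ha : 0 < a) {s : ℂ} (hs : 0 ≤ s.re) :
    ContinuousAt (phiL a) s := by
  unfold phiL
  have := Complex.continuousAt_cpow_const_of_re_pos (z := s) (w := (a:ℂ)) (Or.inl hs) (by simpa)
  exact Complex.continuous_exp.continuousAt.comp this.neg

lemma phiL_hasDerivAt {a : ℝ} {s : ℂ} (hs : 0 < s.re) :
    HasDerivAt (phiL a) (-(a * s ^ ((a : ℂ) - 1) * phiL a s)) s := by
  unfold phiL
  have h := ((hasDerivAt_id s).cpow_const (c := (a:ℂ)) (Or.inl hs)).neg.cexp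
  refine h.congr_deriv ?_
  change Complex.exp (-(s ^ (a : ℂ))) * -(↑a * s ^ ((a : ℂ) - 1) * 1) = _
  ring

lemma phiL_line_continuous {a : ℝ} (ha : 0 < a) {c : ℝ} (hc : 0 ≤ c) :
    Continuous (fun k : ℝ => phiL a ((c : ℂ) + k * Complex.I)) := by
  rw [continuous_iff_continuousAt]
  intro k
  have h1 : ContinuousAt (phiL a) ((c : ℂ) + k * Complex.I) :=
    phiL_continuousAt ha (by simpa)
  exact ContinuousAt.comp (f := fun k : ℝ => (c : ℂ) + k * Complex.I) h1 (by fun_prop)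

/-- The Bromwich integrand -/
noncomputable def brom (a y : ℝ) (s : ℂ) : ℂ := Complex.exp (s * y) * phiL a s

lemma brom_norm {a : ℝ} (y : ℝ) (s : ℂ) :
    ‖brom a y s‖ = Real.exp (s.re * y) * ‖phiL a s‖ := by
  rw [brom, norm_mul, Complex.norm_exp]; simp

lemma brom_integrable {a : ℝ} (ha : 1 / 2 < a) (ha1 : a < 1) (y : ℝ) {c : ℝ} (hc : 0 ≤ c) :
    Integrable (fun k : ℝ => brom a y ((c : ℂ) + k * Complex.I)) := by
  obtain ⟨C, hC, h⟩ := norm_phiL_decay2 ha ha1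
  refine Integrable.mono' ((integrable_inv_one_add_sq.const_mul C).const_mul (Real.exp (c * y)))
    ?_ (Filter.Eventually.of_forall fun k => ?_)
  · apply Continuous.aestronglyMeasurable
    unfold brom
    exact Continuous.mul (by fun_prop) (phiL_line_continuous (by linarith) hc)
  · rw [brom_norm]
    have := h ((c : ℂ) + k * Complex.I) (by simpa)
    simp only [Complex.add_re, Complex.ofReal_re, Complex.mul_re, Complex.I_re, mul_zero,
      Complex.ofReal_im, Complex.I_im, mul_one, sub_self, add_zero, Complex.add_im,
      Complex.mul_im, zero_add] at this ⊢
    gcongr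

lemma brom_shift {a : ℝ} (ha : 1 / 2 < a) (ha1 : a < 1) (y : ℝ) {c : ℝ} (hc : 0 < c) :
    (∫ k : ℝ, brom a y ((c : ℂ) + k * Complex.I)) = ∫ k : ℝ, brom a y ((0 : ℝ) + k * Complex.I) := by
  obtain ⟨C, hC, h⟩ := norm_phiL_decay2 ha ha1
  have ha0 : 0 < a := by linarith
  have key : ∀ R : ℝ, 0 < R →
      ‖(∫ k in (-R)..R, brom a y ((c : ℂ) + k * Complex.I)) -
        ∫ k in (-R)..R, brom a y ((0 : ℝ) + k * Complex.I)‖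
        ≤ 2 * (Real.exp (c * |y|) * (C * (1 + R ^ 2)⁻¹) * c) := by
    intro R hR
    have H := Complex.integral_boundary_rect_eq_zero_of_continuousOn_of_differentiableOn
      (brom a y) ⟨0, -R⟩ ⟨c, R⟩ ?_ ?_
    · simp only [smul_eq_mul] at H
      have hb : ∀ r : ℝ, r ^ 2 = R ^ 2 →
          ‖∫ x in (0:ℝ)..c, brom a y (x + r * Complex.I)‖
            ≤ Real.exp (c * |y|) * (C * (1 + R ^ 2)⁻¹) * c := by
        intro r hr
        have := intervalIntegral.norm_integral_le_of_norm_le_const (a := 0) (b := c)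
          (f := fun x : ℝ => brom a y (x + r * Complex.I))
          (C := Real.exp (c * |y|) * (C * (1 + R ^ 2)⁻¹)) ?_
        · simpa [abs_of_pos hc] using this
        · intro x hx
          rw [uIoc_of_le hc.le] at hx
          rw [brom_norm]
          have h2 := h (x + r * Complex.I) (by simpa using hx.1.le)
          simp only [Complex.add_re, Complex.ofReal_re, Complex.mul_re, Complex.I_re, mul_zero,
            Complex.ofReal_im, Complex.I_im, mul_one, sub_self, add_zero, Complex.add_im,
            Complex.mul_im, zero_add] at h2 ⊢
          rw [hr] at h2
          have h3 : x * y ≤ c * |y| := by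
            have := mul_le_mul_of_nonneg_left (le_abs_self y) hx.1.le
            have := mul_le_mul_of_nonneg_right hx.2 (abs_nonneg y)
            linarith
          gcongr
      have h1 := hb R rfl
      have h2 := hb (-R) (by ring)
      have e : (∫ k in (-R)..R, brom a y ((c : ℂ) + k * Complex.I)) -
        (∫ k in (-R)..R, brom a y ((0 : ℝ) + k * Complex.I)) = Complex.I *
          ((∫ x in (0:ℝ)..c, brom a y (x + ((-R : ℝ):ℂ) * Complex.I)) -
          ∫ x in (0:ℝ)..c, brom a y (x + R * Complex.I)) := by
        linear_combination (-Complex.I) * H + ((∫ k in (-R)..R, brom a y ((c : ℂ) + k * Complex.I)) -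
        (∫ k in (-R)..R, brom a y ((0 : ℝ) + k * Complex.I))) * Complex.I_sq
      rw [e, norm_mul, Complex.norm_I, one_mul]
      refine (norm_sub_le _ _).trans ?_
      linarith
    · intro s hs
      rw [Complex.mem_reProdIm] at hs
      have hs1 : 0 ≤ s.re := by
        have := hs.1; simp only [uIcc_of_le hc.le] at this; exact this.1
      unfold brom
      exact (ContinuousAt.mul (by fun_prop) (phiL_continuousAt ha0 hs1)).continuousWithinAt
    · intro s hs
      rw [Complex.mem_reProdIm] at hs
      have hs1 : 0 < s.re := by
        have := hs.1; simp only [min_eq_left hc.le] at this; exact this.1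
      unfold brom
      exact (DifferentiableAt.mul (by fun_prop)
        (phiL_hasDerivAt hs1).differentiableAt).differentiableWithinAt
  have t1 := intervalIntegral_tendsto_integral (brom_integrable ha ha1 y hc.le)
    Filter.tendsto_neg_atTop_atBot Filter.tendsto_id
  have t2 := intervalIntegral_tendsto_integral (brom_integrable ha ha1 y le_rfl)
    Filter.tendsto_neg_atTop_atBot Filter.tendsto_id
  have t3 := (t1.sub t2).norm
  have t4 : Filter.Tendsto (fun R : ℝ => 2 * (Real.exp (c * |y|) * (C * (1 + R ^ 2)⁻¹) * c))
      Filter.atTop (nhds (2 * (Real.exp (c * |y|) * (C * 0) * c))) := by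
    have : Filter.Tendsto (fun R : ℝ => (1 + R ^ 2)⁻¹) Filter.atTop (nhds 0) :=
      Filter.Tendsto.inv_tendsto_atTop
        (Filter.tendsto_atTop_add_const_left _ _ (Filter.tendsto_pow_atTop (by norm_num)))
    exact (((this.const_mul C).const_mul _).mul_const c).const_mul 2
  have t5 := le_of_tendsto_of_tendsto t3 t4
    (by filter_upwards [Filter.eventually_gt_atTop 0] with R hR using key R hR)
  simp only [mul_zero, zero_mul] at t5
  exact sub_eq_zero.1 (norm_le_zero_iff.1 t5)

lemma brom_zero {a : ℝ} (ha : 1 / 2 < a) (ha1 : a < 1) {y : ℝ} (hy : y < 0) :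
    ∫ k : ℝ, brom a y ((0 : ℝ) + k * Complex.I) = 0 := by
  obtain ⟨C, hC, h⟩ := norm_phiL_decay2 ha ha1
  have key : ∀ c : ℝ, 0 < c → ‖∫ k : ℝ, brom a y ((0 : ℝ) + k * Complex.I)‖ ≤
      Real.exp (c * y) * ∫ k : ℝ, C * (1 + k ^ 2)⁻¹ := by
    intro c hc
    rw [← brom_shift ha ha1 y hc, ← integral_const_mul]
    refine norm_integral_le_of_norm_le
      ((integrable_inv_one_add_sq.const_mul C).const_mul (Real.exp (c * y)))
      (Filter.Eventually.of_forall fun k => ?_)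
    rw [brom_norm]
    have := h ((c : ℂ) + k * Complex.I) (by simpa using hc.le)
    simp only [Complex.add_re, Complex.ofReal_re, Complex.mul_re, Complex.I_re, mul_zero,
      Complex.ofReal_im, Complex.I_im, mul_one, sub_self, add_zero, Complex.add_im,
      Complex.mul_im, zero_add] at this ⊢
    gcongr
  have t : Filter.Tendsto (fun c : ℝ => Real.exp (c * y) * ∫ k : ℝ, C * (1 + k ^ 2)⁻¹) Filter.atTop
      (nhds (0 * ∫ k : ℝ, C * (1 + k ^ 2)⁻¹)) := by
    refine Filter.Tendsto.mul_const _ (Real.tendsto_exp_atBot.comp ?_)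
    exact Filter.tendsto_id.atTop_mul_const_of_neg hy
  have := ge_of_tendsto t
    (by filter_upwards [Filter.eventually_gt_atTop 0] with c hc using key c hc)
  rw [zero_mul] at this
  exact norm_le_zero_iff.1 this

lemma stableCF_eq {α : ℝ} (hα : 1 < α) (k : ℝ) :
    stableCF (1 / α) 1 (|Real.cos (Real.pi / (2 * α))| ^ α) 0 k
      = phiL (1 / α) ((0 : ℝ) + (-k : ℝ) * Complex.I) := by
  have hα0 : 0 < α := by linarith
  have ha1 : 1 / α < 1 := by rw [div_lt_one hα0]; exact hα
  have ha0 : 0 < 1 / α := by positivity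
  have e1 : Real.pi / (2 * α) = Real.pi / 2 * (1 / α) := by field_simp
  have e2 : 1 / α * Real.pi / 2 = Real.pi / 2 * (1 / α) := by field_simp
  have hk := kappa_pos ha0 ha1
  rw [stableCF, phiL, e1, e2, abs_of_pos hk, ← Real.rpow_mul hk.le, mul_one_div_cancel hα0.ne',
    Real.rpow_one, Complex.cpow_ofReal, Real.tan_eq_sin_div_cos]
  set a := 1 / α
  congr 1
  have hkc : (Complex.cos (Real.pi / 2 * a)) ≠ 0 := by
    have : ((Real.cos (Real.pi / 2 * a) : ℝ) : ℂ) ≠ 0 := by exact_mod_cast hk.ne'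
    simpa using this
  have hn : ‖((0:ℝ):ℂ) + (-k : ℝ) * Complex.I‖ = |k| := by simp
  rw [hn]
  rcases lt_trichotomy k 0 with h | h | h
  · have harg : (((0:ℝ):ℂ) + (-k : ℝ) * Complex.I).arg = Real.pi / 2 := by
      rw [Complex.ofReal_zero, zero_add, Complex.arg_real_mul _ (by linarith), Complex.arg_I]
    rw [harg, Real.sign_of_neg h]
    push_cast
    generalize Complex.cos (Real.pi / 2 * a) = C at *
    generalize Complex.sin (Real.pi / 2 * a) = S at *
    field_simp
    ring
  · subst h
    simp [Real.zero_rpow ha0.ne']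
  · have harg : (((0:ℝ):ℂ) + (-k : ℝ) * Complex.I).arg = -(Real.pi / 2) := by
      have : (((0:ℝ):ℂ) + (-k : ℝ) * Complex.I) = (k:ℝ) * (-Complex.I) := by push_cast; ring
      rw [this, Complex.arg_real_mul _ h, Complex.arg_neg_I]
    rw [harg, Real.sign_of_pos h, neg_mul, Real.cos_neg, Real.sin_neg]
    push_cast
    generalize Complex.cos (Real.pi / 2 * a) = C at *
    generalize Complex.sin (Real.pi / 2 * a) = S at *
    field_simp
    ring

lemma g_inversion {a : ℝ} (ha : 1 / 2 < a) (ha1 : a < 1) {g : ℝ → ℝ} (hc : Continuous g)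
    (hi : Integrable g)
    (hF : ∀ k : ℝ, (∫ x : ℝ, Complex.exp (Complex.I * (k : ℂ) * (x : ℂ)) * (g x : ℂ))
      = phiL a ((0 : ℝ) + (-k : ℝ) * Complex.I)) (y : ℝ) :
    (g y : ℂ) = 1 / (2 * Real.pi) * ∫ k : ℝ, brom a y ((0 : ℝ) + k * Complex.I) := by
  have hfour : ∀ w : ℝ, FourierTransform.fourier (fun x => (g x : ℂ)) w
      = phiL a ((0 : ℝ) + (2 * Real.pi * w : ℝ) * Complex.I) := by
    intro w
    rw [Real.fourier_real_eq_integral_exp_smul]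
    have := hF (-(2 * Real.pi * w))
    rw [neg_neg] at this
    rw [← this]
    congr 1; ext x
    rw [smul_eq_mul]
    congr 2
    push_cast; ring
  have hInteg : Integrable (FourierTransform.fourier (fun x => (g x : ℂ))) := by
    have h1 := brom_integrable ha ha1 0 le_rfl
    have h2 := h1.comp_mul_left' (R := 2 * Real.pi) (by positivity)
    refine h2.congr (Filter.Eventually.of_forall fun w => ?_)
    simp only [hfour, brom]
    simp
  have hinv := Continuous.fourierInv_fourier_eq (f := fun x => (g x : ℂ))
    (Complex.continuous_ofReal.comp hc) hi.ofReal hInteg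
  have h3 := congrFun hinv y
  rw [← h3, Real.fourierInv_eq']
  have h4 := Measure.integral_comp_mul_left
    (fun k : ℝ => brom a y ((0 : ℝ) + k * Complex.I)) (2 * Real.pi)
  rw [abs_of_pos (by positivity)] at h4
  have h5 : (1 / (2 * (Real.pi:ℂ)) * ∫ k : ℝ, brom a y ((0 : ℝ) + k * Complex.I))
      = (2 * Real.pi)⁻¹ • ∫ k : ℝ, brom a y ((0 : ℝ) + k * Complex.I) := by
    rw [Complex.real_smul]; push_cast; ring
  rw [h5, ← h4]
  congr 1; ext w
  rw [hfour, brom, smul_eq_mul]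
  congr 2
  simp
  ring

/-! ### Complex Gamma integral -/

lemma gamma_laplace {p : ℝ} (hp : 0 < p) {s : ℂ} (hs : 0 < s.re) :
    (∫ τ in Ioi (0 : ℝ), ((τ ^ (p - 1) : ℝ) : ℂ) * Complex.exp (-(s * τ)))
      = s ^ ((-p : ℝ) : ℂ) * (Real.Gamma p : ℂ) := by
  have hbase : ∀ (q : ℝ) (c : ℝ), -1 < q → 0 < c →
      IntegrableOn (fun τ : ℝ => τ ^ q * Real.exp (-c * τ)) (Ioi 0) := by
    intro q c hq hc
    have := integrableOn_rpow_mul_exp_neg_mul_rpow hq one_pos hc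
    simpa using this
  have hnorm : ∀ (q : ℝ) (z : ℂ) (τ : ℝ), 0 < τ →
      ‖((τ ^ q : ℝ) : ℂ) * Complex.exp (-(z * τ))‖ = τ ^ q * Real.exp (-z.re * τ) := by
    intro q z τ hτ
    rw [norm_mul, Complex.norm_exp, Complex.norm_real, Real.norm_of_nonneg (by positivity)]
    simp
  have hmeas : ∀ (q : ℝ) (z : ℂ), Measurable (fun τ : ℝ => ((τ ^ q : ℝ) : ℂ) * Complex.exp (-(z * τ))) := by
    intro q z
    exact (Complex.measurable_ofReal.comp (measurable_id.pow_const q)).mul (by fun_prop)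
  have hopen : IsOpen {z : ℂ | 0 < z.re} := isOpen_lt continuous_const Complex.continuous_re
  have hconv : IsPreconnected {z : ℂ | 0 < z.re} :=
    (convex_halfSpace_re_gt 0).isPreconnected
  have hM : DifferentiableOn ℂ (fun z : ℂ => ∫ τ in Ioi (0 : ℝ),
      ((τ ^ (p - 1) : ℝ) : ℂ) * Complex.exp (-(z * τ))) {z : ℂ | 0 < z.re} := by
    intro z₀ hz₀
    have hz₀' : 0 < z₀.re := hz₀
    refine DifferentiableAt.differentiableWithinAt ?_
    have := hasDerivAt_integral_of_dominated_loc_of_deriv_le (μ := volume.restrict (Ioi (0:ℝ)))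
      (F := fun (z : ℂ) (τ : ℝ) => ((τ ^ (p - 1) : ℝ) : ℂ) * Complex.exp (-(z * τ)))
      (F' := fun (z : ℂ) (τ : ℝ) => -(((τ ^ p : ℝ) : ℂ) * Complex.exp (-(z * τ))))
      (x₀ := z₀) (s := {z : ℂ | z₀.re / 2 < z.re})
      (bound := fun τ => τ ^ p * Real.exp (-(z₀.re / 2) * τ))
      ((isOpen_lt continuous_const Complex.continuous_re).mem_nhds (by simp; linarith))
      (Filter.Eventually.of_forall fun z => (hmeas _ z).aestronglyMeasurable)
      ?_ (hmeas _ z₀).neg.aestronglyMeasurable ?_ (hbase p _ (by linarith) (by linarith)) ?_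
    · exact this.2.differentiableAt
    · refine Integrable.mono' (hbase (p - 1) z₀.re (by linarith) hz₀')
        (hmeas _ _).aestronglyMeasurable ?_
      filter_upwards [ae_restrict_mem measurableSet_Ioi] with τ hτ
      rw [hnorm _ _ _ hτ]
    · filter_upwards [ae_restrict_mem measurableSet_Ioi] with τ hτ z hz
      have hτ' : 0 < τ := hτ
      rw [norm_neg, hnorm _ _ _ hτ]
      have hz' : z₀.re / 2 < z.re := hz
      gcongr
    · filter_upwards [ae_restrict_mem measurableSet_Ioi] with τ hτ z hz
      have hτ' : 0 < τ := hτ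
      have h1 : HasDerivAt (fun z : ℂ => Complex.exp (-(z * τ)))
          (Complex.exp (-(z * τ)) * -(1 * (τ:ℂ))) z :=
        ((hasDerivAt_id z).mul_const (τ : ℂ)).neg.cexp
      refine (h1.const_mul ((τ ^ (p - 1) : ℝ) : ℂ)).congr_deriv ?_
      have h2 : τ ^ p = τ ^ (p - 1) * τ := by
        rw [Real.rpow_sub_one hτ'.ne']; field_simp
      rw [h2]; push_cast; ring
  have hR : DifferentiableOn ℂ (fun z : ℂ => z ^ ((-p : ℝ) : ℂ) * (Real.Gamma p : ℂ))
      {z : ℂ | 0 < z.re} := by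
    intro z hz
    refine DifferentiableAt.differentiableWithinAt ?_
    exact (((hasDerivAt_id z).cpow_const (c := ((-p : ℝ) : ℂ)) (Or.inl hz)).mul_const _).differentiableAt
  have hfreq : ∃ᶠ z in nhdsWithin (1 : ℂ) {1}ᶜ,
      (∫ τ in Ioi (0 : ℝ), ((τ ^ (p - 1) : ℝ) : ℂ) * Complex.exp (-(z * τ)))
        = z ^ ((-p : ℝ) : ℂ) * (Real.Gamma p : ℂ) := by
    have ht : Filter.Tendsto (fun r : ℝ => (r : ℂ)) (nhdsWithin 1 (Ioi 1)) (nhdsWithin (1:ℂ) {1}ᶜ) := by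
      refine tendsto_nhdsWithin_iff.2 ⟨?_, ?_⟩
      · have : Filter.Tendsto (fun r : ℝ => (r : ℂ)) (nhds 1) (nhds ((1:ℝ):ℂ)) :=
          Complex.continuous_ofReal.tendsto 1
        rw [Complex.ofReal_one] at this
        exact this.mono_left nhdsWithin_le_nhds
      · filter_upwards [self_mem_nhdsWithin] with r hr
        have : (1:ℝ) < r := hr
        simp only [mem_compl_iff, mem_singleton_iff]
        exact_mod_cast this.ne'
    refine ht.frequently (Filter.Eventually.frequently ?_)
    filter_upwards [self_mem_nhdsWithin] with r hr
    have hr1 : (1:ℝ) < r := hr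
    have hr0 : 0 < r := by linarith
    have h1 := Real.integral_rpow_mul_exp_neg_mul_Ioi hp hr0
    have h2 : ∀ τ : ℝ, ((τ ^ (p - 1) : ℝ) : ℂ) * Complex.exp (-((r:ℂ) * τ))
        = ((τ ^ (p - 1) * Real.exp (-(r * τ)) : ℝ) : ℂ) := by
      intro τ; push_cast; rfl
    simp only [h2]
    rw [integral_complex_ofReal, h1, Complex.ofReal_mul, one_div, Real.inv_rpow hr0.le,
      ← Real.rpow_neg hr0.le, Complex.ofReal_cpow hr0.le]
  exact (hM.analyticOnNhd hopen).eqOn_of_preconnected_of_frequently_eq (hR.analyticOnNhd hopen)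
    hconv (by simp : (1:ℂ) ∈ {z : ℂ | 0 < z.re}) hfreq hs

/-! ### The Bromwich integrals on the line `Re s = 1` -/

/-- the integrand `e^{sy} s^b e^{-s^a}` -/
noncomputable def bw (a b y : ℝ) (s : ℂ) : ℂ :=
  Complex.exp (s * y) * (s ^ (b : ℂ) * phiL a s)

/-- the point `1 + i k` -/
noncomputable def ln (k : ℝ) : ℂ := (1 : ℝ) + k * Complex.I

lemma ln_re (k : ℝ) : (ln k).re = 1 := by simp [ln]

lemma ln_norm_sq (k : ℝ) : ‖ln k‖ ^ 2 = 1 + k ^ 2 := by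
  rw [← Complex.normSq_eq_norm_sq, Complex.normSq_apply]; simp [ln]; ring

lemma ln_norm (k : ℝ) : 1 ≤ ‖ln k‖ := by
  have h := ln_norm_sq k
  nlinarith [norm_nonneg (ln k), sq_nonneg k]

lemma ln_hasDerivAt (k : ℝ) : HasDerivAt ln Complex.I k := by
  unfold ln
  have := ((hasDerivAt_id (k:ℂ)).comp_ofReal.mul_const Complex.I).const_add ((1:ℝ):ℂ)
  simpa using this

lemma ln_continuous : Continuous ln := by unfold ln; fun_prop

noncomputable def bl (a b y : ℝ) : ℂ := ∫ k : ℝ, bw a b y (ln k)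

lemma bw_hasDerivAt {a b y : ℝ} {s : ℂ} (hs : 0 < s.re) :
    HasDerivAt (bw a b y) (y * bw a b y s + b * bw a (b - 1) y s - a * bw a (b + a - 1) y s) s := by
  have h1 : HasDerivAt (fun s : ℂ => Complex.exp (s * y)) (Complex.exp (s * y) * (1 * y)) s :=
    ((hasDerivAt_id s).mul_const (y : ℂ)).cexp
  have h2 : HasDerivAt (fun s : ℂ => s ^ (b : ℂ)) (b * s ^ ((b : ℂ) - 1) * 1) s :=
    (hasDerivAt_id s).cpow_const (Or.inl hs)
  refine (h1.mul (h2.mul (phiL_hasDerivAt hs))).congr_deriv ?_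
  have hs0 : s ≠ 0 := by rintro rfl; simp at hs
  have e : s ^ ((b : ℂ) + a - 1) = s ^ (b : ℂ) * s ^ ((a : ℂ) - 1) := by
    rw [← Complex.cpow_add _ _ hs0]; congr 1; ring
  simp only [bw, Pi.mul_apply]
  push_cast
  rw [e]
  ring

lemma bw_line_continuous (a b y : ℝ) : Continuous (fun k => bw a b y (ln k)) := by
  rw [continuous_iff_continuousAt]
  intro k
  exact ContinuousAt.comp (f := ln) (bw_hasDerivAt (by rw [ln_re]; norm_num)).continuousAt
    ln_continuous.continuousAt

lemma bw_bound {a : ℝ} (ha : 1 / 2 < a) (ha1 : a < 1) :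
    ∃ C : ℝ, 0 < C ∧ ∀ b y k : ℝ, b ≤ 2 →
      ‖bw a b y (ln k)‖ ≤ Real.exp y * (C * (1 + k ^ 2)⁻¹) := by
  obtain ⟨C, hC, h⟩ := norm_phiL_decay ha ha1
  refine ⟨C, hC, fun b y k hb => ?_⟩
  have h1 := ln_norm k
  have h2 := h (ln k) (by rw [ln_re]; norm_num) h1
  rw [bw, norm_mul, Complex.norm_exp, norm_mul, Complex.norm_cpow_real]
  have h3 : ((ln k) * (y : ℂ)).re = y := by simp [ln_re]
  rw [h3]
  refine mul_le_mul_of_nonneg_left ?_ (Real.exp_pos y).le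
  have h4 : ‖ln k‖ ^ b ≤ 1 + k ^ 2 := by
    rw [← ln_norm_sq, ← Real.rpow_natCast]
    exact Real.rpow_le_rpow_of_exponent_le h1 (by simpa)
  have h5 : ‖ln k‖ ^ 4 = (1 + k ^ 2) ^ 2 := by rw [← ln_norm_sq]; ring
  calc ‖ln k‖ ^ b * ‖phiL a (ln k)‖ ≤ (1 + k ^ 2) * (C * (‖ln k‖ ^ 4)⁻¹) := by gcongr
    _ = _ := by
      rw [h5]
      field_simp

lemma bw_integrable {a : ℝ} (ha : 1 / 2 < a) (ha1 : a < 1) {b : ℝ} (hb : b ≤ 2) (y : ℝ) :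
    Integrable (fun k => bw a b y (ln k)) := by
  obtain ⟨C, hC, h⟩ := bw_bound ha ha1
  exact Integrable.mono' ((integrable_inv_one_add_sq.const_mul C).const_mul (Real.exp y))
    (bw_line_continuous a b y).aestronglyMeasurable
    (Filter.Eventually.of_forall fun k => h b y k hb)

lemma bl_parts {a : ℝ} (ha : 1 / 2 < a) (ha1 : a < 1) {b : ℝ} (hb : b ≤ 2) (y : ℝ) :
    y * bl a b y + b * bl a (b - 1) y - a * bl a (b + a - 1) y = 0 := by
  have i1 := (bw_integrable ha ha1 hb y).const_mul (y : ℂ)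
  have i2 := (bw_integrable ha ha1 (by linarith : b - 1 ≤ 2) y).const_mul (b : ℂ)
  have i3 := (bw_integrable ha ha1 (by linarith : b + a - 1 ≤ 2) y).const_mul (a : ℂ)
  have H := integral_eq_zero_of_hasDerivAt_of_integrable
    (f := fun k => bw a b y (ln k))
    (f' := fun k => (y * bw a b y (ln k) + b * bw a (b - 1) y (ln k)
      - a * bw a (b + a - 1) y (ln k)) * Complex.I)
    (fun k => HasDerivAt.comp (h := ln) k (bw_hasDerivAt (by rw [ln_re]; norm_num)) (ln_hasDerivAt k))
    (((i1.add i2).sub i3).mul_const _) (bw_integrable ha ha1 hb y)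
  rw [integral_mul_const, mul_eq_zero, or_iff_left Complex.I_ne_zero] at H
  rw [integral_sub (by exact i1.add i2) i3, integral_add i1 i2, integral_const_mul, integral_const_mul,
    integral_const_mul] at H
  exact H

lemma bl_hasDerivAt {a : ℝ} (ha : 1 / 2 < a) (ha1 : a < 1) {b : ℝ} (hb : b ≤ 1) (y : ℝ) :
    HasDerivAt (bl a b) (bl a (b + 1) y) y := by
  obtain ⟨C, hC, h⟩ := bw_bound ha ha1
  have := hasDerivAt_integral_of_dominated_loc_of_deriv_le (μ := (volume : Measure ℝ))
      (F := fun (y : ℝ) (k : ℝ) => bw a b y (ln k))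
      (F' := fun (y : ℝ) (k : ℝ) => bw a (b + 1) y (ln k))
      (x₀ := y) (s := Iio (y + 1))
      (bound := fun k => Real.exp (y + 1) * (C * (1 + k ^ 2)⁻¹))
      (Iio_mem_nhds (by linarith))
      (Filter.Eventually.of_forall fun z => (bw_line_continuous a b z).aestronglyMeasurable)
      (bw_integrable ha ha1 (by linarith) y) (bw_line_continuous a _ y).aestronglyMeasurable
      (Filter.Eventually.of_forall fun k z hz => ?_)
      ((integrable_inv_one_add_sq.const_mul C).const_mul _)
      (Filter.Eventually.of_forall fun k z hz => ?_)
  · exact this.2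
  · refine (h (b + 1) z k (by linarith)).trans ?_
    have hz' : z < y + 1 := hz
    gcongr
  · have h1 : HasDerivAt (fun z : ℝ => Complex.exp (ln k * z))
        (Complex.exp (ln k * z) * (ln k * 1)) z := by
      exact ((hasDerivAt_id (z:ℂ)).comp_ofReal.const_mul (ln k)).cexp
    refine (h1.mul_const ((ln k) ^ (b : ℂ) * phiL a (ln k))).congr_deriv ?_
    have h0 : ln k ≠ 0 := by
      intro h; have := ln_re k; rw [h] at this; simp at this
    rw [bw]
    push_cast
    rw [Complex.cpow_add _ _ h0, Complex.cpow_one]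
    ring

lemma bl_conv {a : ℝ} (ha : 1 / 2 < a) (ha1 : a < 1) (y : ℝ) :
    (∫ τ in Ioi (0:ℝ), ((τ ^ (-a) : ℝ) : ℂ) * bl a a (y - τ))
      = Real.Gamma (1 - a) * bl a (2 * a - 1) y := by
  have hsplit : ∀ τ k : ℝ, ((τ ^ (-a) : ℝ) : ℂ) * bw a a (y - τ) (ln k)
      = (((τ ^ (-a) : ℝ) : ℂ) * Complex.exp (-(ln k * τ))) * bw a a y (ln k) := by
    intro τ k
    simp only [bw]
    have : Complex.exp (ln k * ((y - τ : ℝ) : ℂ)) = Complex.exp (-(ln k * τ)) * Complex.exp (ln k * y) := by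
      rw [← Complex.exp_add]; congr 1; push_cast; ring
    rw [this]; ring
  have hInteg : Integrable (Function.uncurry fun (τ k : ℝ) =>
      (((τ ^ (-a) : ℝ) : ℂ) * Complex.exp (-(ln k * τ))) * bw a a y (ln k))
      ((volume.restrict (Ioi (0:ℝ))).prod volume) := by
    have h1 : IntegrableOn (fun τ : ℝ => τ ^ (-a) * Real.exp (-1 * τ)) (Ioi 0) := by
      have := integrableOn_rpow_mul_exp_neg_mul_rpow (by linarith : -1 < -a) one_pos one_pos
      simpa using this
    have h2 := Integrable.mul_prod (μ := volume.restrict (Ioi (0:ℝ))) (ν := volume) h1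
      (bw_integrable ha ha1 (by linarith : a ≤ 2) y).norm
    refine h2.mono ?_ ?_
    · apply Measurable.aestronglyMeasurable
      have m1 : Measurable (fun p : ℝ × ℝ => ((p.1 ^ (-a) : ℝ) : ℂ)) :=
        Complex.measurable_ofReal.comp (measurable_fst.pow_const _)
      have m2 : Measurable (fun p : ℝ × ℝ => Complex.exp (-(ln p.2 * p.1))) := by
        apply Continuous.measurable
        have := ln_continuous
        fun_prop
      have m3 : Measurable (fun p : ℝ × ℝ => bw a a y (ln p.2)) :=
        ((bw_line_continuous a a y).comp continuous_snd).measurable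
      exact (m1.mul m2).mul m3
    · refine Filter.Eventually.of_forall fun p => le_of_eq ?_
      simp only [Function.uncurry, norm_mul, Complex.norm_exp, Complex.norm_real, norm_norm]
      congr 2
      simp [ln_re]
  have e1 : (∫ τ in Ioi (0:ℝ), ((τ ^ (-a) : ℝ) : ℂ) * bl a a (y - τ))
      = ∫ τ in Ioi (0:ℝ), ∫ k : ℝ,
        (((τ ^ (-a) : ℝ) : ℂ) * Complex.exp (-(ln k * τ))) * bw a a y (ln k) := by
    congr 1; ext τ
    rw [bl, ← integral_const_mul]
    simp only [hsplit]
  rw [e1, integral_integral_swap hInteg, bl, ← integral_const_mul]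
  congr 1; ext k
  rw [integral_mul_const]
  have h3 := gamma_laplace (p := 1 - a) (by linarith) (s := ln k) (by rw [ln_re]; norm_num)
  rw [show 1 - a - 1 = -a by ring] at h3
  rw [h3]
  have h0 : ln k ≠ 0 := by
    intro h; have := ln_re k; rw [h] at this; simp at this
  simp only [bw]
  have : ln k ^ ((2 * a - 1 : ℝ) : ℂ) = ln k ^ ((-(1 - a) : ℝ) : ℂ) * ln k ^ (a : ℂ) := by
    rw [← Complex.cpow_add _ _ h0]; congr 1; push_cast; ring
  rw [this]; ring

section core

variable {a : ℝ} {g : ℝ → ℝ}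

lemma core_g (ha : 1 / 2 < a) (ha1 : a < 1)
    (hg : ∀ y : ℝ, (g y : ℂ) = 1 / (2 * Real.pi) * ∫ k : ℝ, brom a y ((0 : ℝ) + k * Complex.I))
    (y : ℝ) : (g y : ℂ) = 1 / (2 * Real.pi) * bl a 0 y := by
  rw [hg, ← brom_shift ha ha1 y one_pos]
  congr 2
  ext k
  simp [bw, brom, ln]

lemma core_G (ha : 1 / 2 < a) (ha1 : a < 1)
    (hg : ∀ y : ℝ, (g y : ℂ) = 1 / (2 * Real.pi) * ∫ k : ℝ, brom a y ((0 : ℝ) + k * Complex.I))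
    (y : ℝ) : ((y * g y : ℝ) : ℂ) = a / (2 * Real.pi) * bl a (a - 1) y := by
  have h := bl_parts ha ha1 (by norm_num : (0:ℝ) ≤ 2) y
  rw [zero_add] at h
  push_cast at h ⊢
  rw [core_g ha ha1 hg]
  linear_combination 1 / (2 * (Real.pi:ℂ)) * h

lemma core_deriv (ha : 1 / 2 < a) (ha1 : a < 1)
    (hg : ∀ y : ℝ, (g y : ℂ) = 1 / (2 * Real.pi) * ∫ k : ℝ, brom a y ((0 : ℝ) + k * Complex.I))
    (y : ℝ) : DifferentiableAt ℝ (fun y => y * g y) y ∧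
      ((deriv (fun y => y * g y) y : ℝ) : ℂ) = a / (2 * Real.pi) * bl a a y := by
  have h1 : HasDerivAt (fun y : ℝ => ((y * g y : ℝ) : ℂ)) (a / (2 * Real.pi) * bl a a y) y := by
    have := (bl_hasDerivAt ha ha1 (by linarith : a - 1 ≤ 1) y).const_mul ((a:ℂ) / (2 * Real.pi))
    rw [sub_add_cancel] at this
    refine this.congr_of_eventuallyEq (Filter.Eventually.of_forall fun z => ?_)
    exact core_G ha ha1 hg z
  have h2 : DifferentiableAt ℝ (fun y => y * g y) y := by
    have := (Complex.reCLM.hasFDerivAt.comp_hasDerivAt y h1).differentiableAt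
    exact this
  exact ⟨h2, h2.hasDerivAt.ofReal_comp.unique h1⟩

lemma core_deriv_neg (ha : 1 / 2 < a) (ha1 : a < 1)
    (hg : ∀ y : ℝ, (g y : ℂ) = 1 / (2 * Real.pi) * ∫ k : ℝ, brom a y ((0 : ℝ) + k * Complex.I))
    {y : ℝ} (hy : y < 0) : deriv (fun y => y * g y) y = 0 := by
  have : (fun y => y * g y) =ᶠ[nhds y] fun _ => 0 := by
    filter_upwards [Iio_mem_nhds hy] with z hz
    have h := hg z
    rw [brom_zero ha ha1 hz, mul_zero] at h
    have h' : g z = 0 := by exact_mod_cast h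
    rw [h', mul_zero]
  rw [this.deriv_eq]; simp

lemma core_eq (ha : 1 / 2 < a) (ha1 : a < 1)
    (hg : ∀ y : ℝ, (g y : ℂ) = 1 / (2 * Real.pi) * ∫ k : ℝ, brom a y ((0 : ℝ) + k * Complex.I))
    (y : ℝ) :
    (∫ w in Ioo (0:ℝ) y, (y - w) ^ (-a) * deriv (fun y => y * g y) w)
      = Real.Gamma (1 - a) * (y * g y + 1 / a * (y * deriv (fun y => y * g y) y)) := by
  set D : ℝ → ℝ := deriv (fun y => y * g y) with hD
  have e1 : (∫ w in Ioo (0:ℝ) y, (y - w) ^ (-a) * D w)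
      = ∫ τ in Ioi (0:ℝ), τ ^ (-a) * D (y - τ) := by
    rw [← integral_indicator measurableSet_Ioo, ← integral_indicator measurableSet_Ioi,
      ← integral_sub_left_eq_self _ volume y]
    apply integral_congr_ae
    have hne : ∀ᵐ τ : ℝ, τ ≠ y := by
      simp [ae_iff]
    filter_upwards [hne] with τ hτ
    by_cases h1 : 0 < τ
    · by_cases h2 : τ < y
      · rw [indicator_of_mem (by constructor <;> linarith), indicator_of_mem (by exact h1),
          sub_sub_cancel]
      · rw [indicator_of_notMem (by rintro ⟨h, -⟩; linarith), indicator_of_mem (by exact h1)]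
        have h3 : y - τ < 0 := by
          rcases lt_or_eq_of_le (not_lt.1 h2) with h | h
          · linarith
          · exact absurd h.symm hτ
        rw [hD, core_deriv_neg ha ha1 hg h3, mul_zero]
    · rw [indicator_of_notMem (by rintro ⟨-, h⟩; linarith), indicator_of_notMem (by exact h1)]
  have e2 : ((∫ τ in Ioi (0:ℝ), τ ^ (-a) * D (y - τ) : ℝ) : ℂ)
      = a / (2 * Real.pi) * (Real.Gamma (1 - a) * bl a (2 * a - 1) y) := by
    rw [← bl_conv ha ha1, ← integral_complex_ofReal, ← integral_const_mul]
    congr 1; ext τ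
    rw [Complex.ofReal_mul, hD, (core_deriv ha ha1 hg (y - τ)).2]
    ring
  rw [e1]
  apply Complex.ofReal_injective
  rw [e2]
  have h := bl_parts ha ha1 (by linarith : a ≤ 2) y
  rw [show a + a - 1 = 2 * a - 1 by ring] at h
  rw [Complex.ofReal_mul, Complex.ofReal_add, core_G ha ha1 hg, Complex.ofReal_mul,
    Complex.ofReal_mul, hD, (core_deriv ha ha1 hg y).2]
  have ha0 : (a : ℂ) ≠ 0 := by exact_mod_cast (by linarith : a ≠ 0)
  push_cast
  have hpi : (Real.pi : ℂ) ≠ 0 := by exact_mod_cast Real.pi_ne_zero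
  generalize bl a (2 * a - 1) y = X at *
  field_simp
  linear_combination (-(Real.Gamma (1 - a)) : ℂ) * h

end core

/-- The density `h(x,t) = α t x^{−1−α} g(t x^{−α}; 1/α, 1, |cos(π/(2α))|^α, 0)` of the inverse
`1/α`-stable subordinator solves the time-fractional pde of order `1/α`:
the Caputo derivative in time of `h(x,·)` equals `−∂h/∂x`. -/
theorem time_fractional_pde
    (α : ℝ) (hα : 1 < α ∧ α < 2)
    (g : ℝ → ℝ → ℝ → ℝ → ℝ → ℝ)
    (hg : ∀ a β σ v : ℝ, (0 < a ∧ a < 2 ∧ a ≠ 1) → (-1 ≤ β ∧ β ≤ 1) → 0 < σ →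
      IsStableDensity a β σ v (fun x => g x a β σ v))
    (h : ℝ → ℝ → ℝ)
    (hh : ∀ x t : ℝ, h x t
      = α * t * x ^ (-1 - α) * g (t * x ^ (-α)) (1 / α) 1 (|Real.cos (Real.pi / (2 * α))| ^ α) 0)
    (x t : ℝ) (hx : 0 < x) (ht : 0 < t) :
    (1 / Real.Gamma (1 - 1 / α)) *
        ∫ u in Set.Ioo (0 : ℝ) t, (t - u) ^ (-(1 / α)) * deriv (fun v => h x v) u
      = - deriv (fun y => h y t) x := by
  obtain ⟨hα1, hα2⟩ := hα
  have hα0 : 0 < α := by linarith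
  have ha1 : 1 / α < 1 := by rw [div_lt_one hα0]; exact hα1
  have ha : 1 / 2 < 1 / α := one_div_lt_one_div_of_lt hα0 hα2
  have ha0 : 0 < 1 / α := by positivity
  have hσ : 0 < |Real.cos (Real.pi / (2 * α))| ^ α := by
    have e1 : Real.pi / (2 * α) = Real.pi / 2 * (1 / α) := by field_simp
    rw [e1]
    have := kappa_pos ha0 ha1
    positivity
  obtain ⟨hc, hi, hF⟩ := hg (1 / α) 1 (|Real.cos (Real.pi / (2 * α))| ^ α) 0
    ⟨ha0, by linarith, ha1.ne⟩ (by norm_num) hσ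
  set f : ℝ → ℝ := fun y => g y (1 / α) 1 (|Real.cos (Real.pi / (2 * α))| ^ α) 0 with hf
  have hinv := g_inversion ha ha1 hc hi (fun k => by rw [hF, stableCF_eq hα1])
  have hcore := core_eq ha ha1 hinv
  have hdiff := fun y => (core_deriv ha ha1 hinv y).1.hasDerivAt
  set G : ℝ → ℝ := fun y => y * f y with hG
  set D : ℝ → ℝ := deriv G with hD
  have hform : ∀ z : ℝ, 0 < z → ∀ s : ℝ, h z s = α * z⁻¹ * G (s * z ^ (-α)) := by
    intro z hz s
    rw [hh, sub_eq_add_neg, Real.rpow_add hz, Real.rpow_neg_one]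
    simp only [hG, hf]
    ring
  set c : ℝ := x ^ (-α) with hcdef
  have hc0 : 0 < c := by positivity
  have hdt : ∀ u : ℝ, deriv (fun v => h x v) u = α * x⁻¹ * c * D (u * c) := by
    intro u
    have h1 : HasDerivAt (fun v => G (v * c)) (D (u * c) * (1 * c)) u :=
      HasDerivAt.comp (h₂ := G) (h := fun v => v * c) u (hdiff (u * c)) ((hasDerivAt_id u).mul_const c)
    have h2 : (fun v => h x v) = fun v => α * x⁻¹ * G (v * c) := by
      ext v; exact hform x hx v
    rw [h2, (h1.const_mul (α * x⁻¹)).deriv]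
    ring
  have hdx : deriv (fun y => h y t) x
      = -(α * (x ^ 2)⁻¹ * (G (t * c) + α * (t * c * D (t * c)))) := by
    have h1 : HasDerivAt (fun z : ℝ => t * z ^ (-α)) (t * (-α * x ^ (-α - 1))) x :=
      (Real.hasDerivAt_rpow_const (Or.inl hx.ne')).const_mul t
    have h2 : HasDerivAt (fun z : ℝ => G (t * z ^ (-α))) (D (t * c) * (t * (-α * x ^ (-α - 1)))) x :=
      HasDerivAt.comp (h₂ := G) (h := fun z : ℝ => t * z ^ (-α)) x (hdiff (t * c)) h1
    have h3 : HasDerivAt (fun z : ℝ => α * z⁻¹) (α * -(x ^ 2)⁻¹) x :=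
      (hasDerivAt_inv hx.ne').const_mul α
    have h4 : (fun y => h y t) =ᶠ[nhds x] fun z => α * z⁻¹ * G (t * z ^ (-α)) := by
      filter_upwards [Ioi_mem_nhds hx] with z hz using hform z hz t
    have h5 : deriv (fun z => α * z⁻¹ * G (t * z ^ (-α))) x = _ := (h3.mul h2).deriv
    rw [h4.deriv_eq, h5, Real.rpow_sub_one hx.ne', ← hcdef]
    field_simp
    ring
  have hscale : (∫ u in Set.Ioo (0 : ℝ) t, (t - u) ^ (-(1 / α)) * deriv (fun v => h x v) u)
      = α * (x ^ 2)⁻¹ * ∫ w in Ioo (0:ℝ) (t * c), (t * c - w) ^ (-(1 / α)) * D w := by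
    rw [← integral_Ioc_eq_integral_Ioo, ← integral_Ioc_eq_integral_Ioo,
      ← intervalIntegral.integral_of_le ht.le, ← intervalIntegral.integral_of_le (by positivity)]
    have h1 := intervalIntegral.mul_integral_comp_mul_right (a := 0) (b := t)
      (f := fun w => (t * c - w) ^ (-(1 / α)) * D w) c
    rw [zero_mul] at h1
    rw [← h1, ← intervalIntegral.integral_const_mul, ← intervalIntegral.integral_const_mul]
    apply intervalIntegral.integral_congr
    intro u hu
    rw [uIcc_of_le ht.le] at hu
    have h2 : (t * c - u * c) ^ (-(1 / α)) = (t - u) ^ (-(1 / α)) * x := by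
      rw [← sub_mul, Real.mul_rpow (by linarith [hu.2]) hc0.le, hcdef, ← Real.rpow_mul hx.le]
      have : -α * -(1 / α) = 1 := by field_simp
      rw [this, Real.rpow_one]
    simp only [hdt, h2]
    field_simp
  rw [hscale, hcore, hdx]
  have hΓ : Real.Gamma (1 - 1 / α) ≠ 0 := (Real.Gamma_pos_of_pos (by linarith)).ne'
  simp only [one_div_one_div, hG]
  generalize Real.Gamma (1 - 1 / α) = Γ at *
  field_simp
end

section
/- Let α ∈ (1,2) and let p(x,t) = g(x; α, −1, (|cos(απ/2)|·t)^{1/α}, 0) be the negatively skewed stable density, where g denotes the stable density. Then for all x > 0 and s > 0 the Laplace transform in time satisfies ∫_0^∞ e^{−st} p(x,t) dt = (1/α)·s^{−1+1/α}·exp(−x·s^{1/α}). -/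
open MeasureTheory Set

lemma aux_integrable (a c r : ℝ) (ha : 0 < a) (hc : 0 < c) (hr : 1 < r) :
    Integrable (fun k : ℝ => 1 / (a + c * |k| ^ r)) := by
  have h0 : Integrable (fun k : ℝ => (2 ^ r / min a c) * (1 + ‖k‖) ^ (-r)) :=
    (integrable_one_add_norm (by simpa using hr)).const_mul _
  have hmeas : AEStronglyMeasurable (fun k : ℝ => 1 / (a + c * |k| ^ r)) volume := by
    apply Measurable.aestronglyMeasurable
    fun_prop
  refine h0.mono' hmeas (Filter.Eventually.of_forall fun k => ?_)
  have hk : 0 ≤ |k| ^ r := by positivity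
  have hm : 0 < min a c := lt_min ha hc
  have hpos : 0 < a + c * |k| ^ r := by positivity
  have h1 : (1 + |k|) ^ r ≤ 2 ^ r * (1 + |k| ^ r) := by
    rcases le_total |k| 1 with h | h
    · calc (1 + |k|) ^ r ≤ 2 ^ r := by
            apply Real.rpow_le_rpow (by positivity) (by linarith) (by linarith)
        _ ≤ _ := by
            have : (0:ℝ) < 2 ^ r := by positivity
            nlinarith
    · calc (1 + |k|) ^ r ≤ (2 * |k|) ^ r := by
            apply Real.rpow_le_rpow (by positivity) (by linarith) (by linarith)
        _ = 2 ^ r * |k| ^ r := Real.mul_rpow (by positivity) (by positivity)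
        _ ≤ _ := by
            have : (0:ℝ) < 2 ^ r := by positivity
            nlinarith
  have h2 : min a c * (1 + |k| ^ r) ≤ a + c * |k| ^ r := by
    have := min_le_left a c
    have := min_le_right a c
    nlinarith
  rw [Real.norm_eq_abs, abs_of_pos (by positivity), Real.norm_eq_abs, Real.rpow_neg (by positivity),
    ← div_eq_mul_inv, div_div, div_le_div_iff₀ hpos (by positivity)]
  have h3 : (0:ℝ) < 2 ^ r := by positivity
  calc 1 * (min a c * (1 + |k|) ^ r) ≤ min a c * (2 ^ r * (1 + |k| ^ r)) := by
        rw [one_mul]; exact mul_le_mul_of_nonneg_left h1 hm.le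
    _ = 2 ^ r * (min a c * (1 + |k| ^ r)) := by ring
    _ ≤ _ := mul_le_mul_of_nonneg_left h2 h3.le

lemma aux_inversion (f φ : ℝ → ℂ) (hc : Continuous f) (hi : Integrable f) (hφ : Integrable φ)
    (h : ∀ k : ℝ, ∫ x : ℝ, Complex.exp (Complex.I * k * x) * f x = φ k) (x : ℝ) :
    f x = (1 / (2 * Real.pi) : ℝ) * ∫ k : ℝ, Complex.exp (-(k * Complex.I * x)) * φ k := by
  have h1 : ∀ w : ℝ, FourierTransform.fourier f w = φ (-2 * Real.pi * w) := by
    intro w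
    rw [Real.fourier_eq', ← h]
    congr 1; ext v
    simp only [smul_eq_mul, RCLike.inner_apply, conj_trivial]
    congr 2
    push_cast; ring
  have h2 : Integrable (FourierTransform.fourier f) := by
    have : FourierTransform.fourier f = fun w => φ ((-2 * Real.pi) * w) := funext h1
    rw [this]
    exact hφ.comp_mul_left' (by simp [Real.pi_ne_zero])
  have h3 := congrFun (hc.fourierInv_fourier_eq hi h2) x
  rw [← h3, Real.fourierInv_eq']
  have h4 := Measure.integral_comp_mul_left
    (fun k : ℝ => Complex.exp (-(k * Complex.I * x)) * φ k) (-2 * Real.pi)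
  have h5 : |(-2 * Real.pi)⁻¹| = 1 / (2 * Real.pi) := by
    rw [abs_inv, abs_mul, abs_of_pos Real.pi_pos]; norm_num
  rw [h5, Complex.real_smul] at h4
  rw [← h4]
  congr 1; ext v
  rw [h1]
  simp only [smul_eq_mul, RCLike.inner_apply, conj_trivial]
  congr 2
  push_cast; ring

lemma aux_half_plane (F : ℂ → ℂ) (hc : ContinuousOn F {z | 0 ≤ z.re})
    (hd : DifferentiableOn ℂ F {z | 0 < z.re}) (C α R0 : ℝ) (hC : 0 ≤ C) (hα : 1 < α)
    (hb : ∀ z : ℂ, 0 ≤ z.re → R0 ≤ ‖z‖ → ‖F z‖ ≤ C * ‖z‖ ^ (-α))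
    (hi : Integrable fun k : ℝ => F (k * Complex.I)) :
    ∫ k : ℝ, F (k * Complex.I) = 0 := by
  have ht := intervalIntegral_tendsto_integral hi Filter.tendsto_neg_atTop_atBot Filter.tendsto_id
  refine tendsto_nhds_unique ht ?_
  rw [tendsto_zero_iff_norm_tendsto_zero]
  have hlim : Filter.Tendsto (fun R : ℝ => 4 * C * R ^ (-(α - 1))) Filter.atTop (nhds 0) := by
    simpa using (tendsto_rpow_neg_atTop (by linarith : 0 < α - 1)).const_mul (4 * C)
  refine tendsto_of_tendsto_of_tendsto_of_le_of_le' tendsto_const_nhds hlim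
    (Filter.Eventually.of_forall fun _ => norm_nonneg _) ?_
  filter_upwards [Filter.eventually_ge_atTop (max 1 R0)] with R hR
  have hR1 : 1 ≤ R := le_trans (le_max_left _ _) hR
  have hR2 : R0 ≤ R := le_trans (le_max_right _ _) hR
  have hR0 : 0 < R := by linarith
  have hb' : ∀ z : ℂ, 0 ≤ z.re → R ≤ ‖z‖ → ‖F z‖ ≤ C * R ^ (-α) := by
    intro z hz hzR
    refine (hb z hz (hR2.trans hzR)).trans ?_
    exact mul_le_mul_of_nonneg_left (Real.rpow_le_rpow_of_nonpos hR0 hzR (by linarith)) hC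
  have key := Complex.integral_boundary_rect_eq_zero_of_continuousOn_of_differentiableOn F
    (⟨0, -R⟩ : ℂ) (⟨R, R⟩ : ℂ) (hc.mono ?_) (hd.mono ?_)
  · simp only [id]
    have e1 : ‖∫ x : ℝ in (0:ℝ)..R, F (x + ((-R : ℝ) : ℂ) * Complex.I)‖ ≤ C * R ^ (-α) * |R - 0| := by
      apply intervalIntegral.norm_integral_le_of_norm_le_const
      intro x hx
      rw [uIoc_of_le hR0.le] at hx
      apply hb'
      · simpa using hx.1.le
      · refine le_trans ?_ (Complex.abs_im_le_norm _)
        simp [abs_of_pos hR0]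
    have e2 : ‖∫ x : ℝ in (0:ℝ)..R, F (x + (R : ℂ) * Complex.I)‖ ≤ C * R ^ (-α) * |R - 0| := by
      apply intervalIntegral.norm_integral_le_of_norm_le_const
      intro x hx
      rw [uIoc_of_le hR0.le] at hx
      apply hb'
      · simpa using hx.1.le
      · refine le_trans ?_ (Complex.abs_im_le_norm _)
        simp [abs_of_pos hR0]
    have e3 : ‖∫ y : ℝ in (-R)..R, F (R + (y : ℂ) * Complex.I)‖ ≤ C * R ^ (-α) * |R - -R| := by
      apply intervalIntegral.norm_integral_le_of_norm_le_const
      intro x hx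
      apply hb'
      · simpa using hR0.le
      · refine le_trans ?_ (Complex.abs_re_le_norm _)
        simp [abs_of_pos hR0]
    simp only [smul_eq_mul, Complex.ofReal_zero, zero_add] at key
    have key2 : Complex.I * ∫ y : ℝ in (-R)..R, F (y * Complex.I) =
      (∫ x : ℝ in (0:ℝ)..R, F (x + ((-R : ℝ) : ℂ) * Complex.I)) -
      (∫ x : ℝ in (0:ℝ)..R, F (x + (R : ℂ) * Complex.I)) +
      Complex.I * ∫ y : ℝ in (-R)..R, F (R + (y : ℂ) * Complex.I) := by
      linear_combination -key
    have key3 := congrArg norm key2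
    rw [norm_mul, Complex.norm_I, one_mul] at key3
    rw [key3]
    refine (norm_add_le _ _).trans ?_
    rw [norm_mul, Complex.norm_I, one_mul]
    have e4 := norm_sub_le (∫ x : ℝ in (0:ℝ)..R, F (x + ((-R : ℝ) : ℂ) * Complex.I))
      (∫ x : ℝ in (0:ℝ)..R, F (x + (R : ℂ) * Complex.I))
    have e5 : R ^ (-(α - 1)) = R ^ (-α) * R := by
      rw [show -(α - 1) = -α + 1 by ring, Real.rpow_add hR0, Real.rpow_one]
    rw [abs_of_pos (by linarith)] at e1 e2 e3
    rw [e5]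
    linarith
  · intro z hz
    have := hz.1
    simp only [mem_preimage, uIcc_of_le hR0.le] at this
    exact this.1
  · intro z hz
    have := hz.1
    simp only [mem_preimage, min_eq_left hR0.le] at this
    exact this.1

lemma aux_cpow (α k : ℝ) (hα : 1 < α ∧ α < 2) :
    ((k : ℂ) * Complex.I) ^ (α : ℂ) = ((|k| ^ α : ℝ) : ℂ) *
      (Real.cos (α * Real.pi / 2) + Real.sign k * Real.sin (α * Real.pi / 2) * Complex.I) := by
  rcases lt_trichotomy k 0 with hk | hk | hk
  · have e : (k : ℂ) * Complex.I = ((-k : ℝ) : ℂ) * (-Complex.I) := by push_cast; ring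
    have harg : ((k : ℂ) * Complex.I).arg = -(Real.pi / 2) := by
      rw [e, Complex.arg_real_mul _ (by linarith), Complex.arg_neg_I]
    rw [Complex.cpow_ofReal, harg, Real.sign_of_neg hk,
      show -(Real.pi / 2) * α = -(α * Real.pi / 2) by ring, Real.cos_neg, Real.sin_neg]
    simp
  · subst hk
    have : α ≠ 0 := by linarith
    simp [this]
  · have harg : ((k : ℂ) * Complex.I).arg = Real.pi / 2 := by
      rw [Complex.arg_real_mul _ hk, Complex.arg_I]
    rw [Complex.cpow_ofReal, harg, Real.sign_of_pos hk,
      show (Real.pi / 2) * α = α * Real.pi / 2 by ring]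
    simp

lemma aux_cos (α : ℝ) (hα : 1 < α ∧ α < 2) : Real.cos (α * Real.pi / 2) < 0 := by
  apply Real.cos_neg_of_pi_div_two_lt_of_lt <;> nlinarith [Real.pi_pos]

lemma aux_root (α s : ℝ) (hα : 1 < α ∧ α < 2) (hs : 0 < s) (z : ℂ) (hz : 0 ≤ z.re)
    (h : z ^ (α : ℂ) = s) : z = ((s ^ (1 / α) : ℝ) : ℂ) := by
  have hα0 : (α : ℂ) ≠ 0 := by exact_mod_cast (by linarith : α ≠ 0)
  have harg := Complex.abs_arg_le_pi_div_two_iff.2 hz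
  rw [abs_le] at harg
  have him : (Complex.log z * α).im = z.arg * α := by simp [Complex.log_im]
  have := Complex.cpow_mul (x := z) (y := α) (1 / α)
    (by rw [him]; nlinarith [Real.pi_pos]) (by rw [him]; nlinarith [Real.pi_pos])
  rw [mul_one_div_cancel hα0, Complex.cpow_one, h] at this
  rw [this, Complex.ofReal_cpow hs.le]
  push_cast; rfl

lemma aux_cpow_re (α k : ℝ) (hα : 1 < α ∧ α < 2) :
    (((k : ℂ) * Complex.I) ^ (α : ℂ)).re = -(|Real.cos (α * Real.pi / 2)| * |k| ^ α) := by
  rw [aux_cpow α k hα, abs_of_neg (aux_cos α hα), Complex.re_ofReal_mul]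
  have : ((Real.sign k : ℂ) * (Real.sin (α * Real.pi / 2) : ℂ) * Complex.I).re = 0 := by
    rw [← Complex.ofReal_mul, Complex.re_ofReal_mul]; simp
  rw [Complex.add_re, this, Complex.ofReal_re]
  ring

lemma aux_cont (α : ℝ) (hα : 1 < α ∧ α < 2) :
    Continuous (fun k : ℝ => ((k : ℂ) * Complex.I) ^ (α : ℂ)) := by
  rw [continuous_iff_continuousAt]
  intro k
  have h := Complex.continuousAt_cpow_const_of_re_pos (z := (k : ℂ) * Complex.I) (w := α)
    (Or.inl (by simp)) (by simpa using by linarith)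
  have h2 : ContinuousAt (fun k : ℝ => (k : ℂ) * Complex.I) k := by fun_prop
  exact ContinuousAt.comp (f := fun k : ℝ => (k : ℂ) * Complex.I) h h2

lemma aux_exp (a x : ℝ) (ha : 0 < a) (hx : 0 < x) :
    ∫ k : ℝ, Complex.exp (-(k * Complex.I * x)) * (2 * a / (k ^ 2 + a ^ 2) : ℂ)
      = 2 * Real.pi * Complex.exp (-(x * a)) := by
  have hi : Integrable (fun k : ℝ => (2 * a / (k ^ 2 + a ^ 2) : ℂ)) := by
    have h := ((aux_integrable (a ^ 2) 1 2 (by positivity) one_pos (by norm_num)).const_mul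
      (2 * a)).ofReal (𝕜 := ℂ)
    refine h.congr (Filter.Eventually.of_forall fun k => ?_)
    simp [div_eq_mul_inv, add_comm]
  have hI1 : IntegrableOn (fun y : ℝ => ((Real.exp (-(a * |y|)) : ℝ) : ℂ)) (Ioi 0) := by
    refine IntegrableOn.congr_fun (integrableOn_exp_mul_complex_Ioi (a := -a) (by simpa using ha) 0)
      ?_ measurableSet_Ioi
    intro y hy
    simp [abs_of_pos (mem_Ioi.1 hy), neg_mul]
  have hI2 : IntegrableOn (fun y : ℝ => ((Real.exp (-(a * |y|)) : ℝ) : ℂ)) (Iic 0) := by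
    refine IntegrableOn.congr_fun (integrableOn_exp_mul_complex_Iic (a := a) (by simpa using ha) 0)
      ?_ measurableSet_Iic
    intro y hy
    simp [abs_of_nonpos (mem_Iic.1 hy)]
  have hint : Integrable (fun y : ℝ => ((Real.exp (-(a * |y|)) : ℝ) : ℂ)) := by
    rw [← integrableOn_univ, ← Iic_union_Ioi (a := (0:ℝ))]
    exact hI2.union hI1
  have hinv := aux_inversion (fun y : ℝ => ((Real.exp (-(a * |y|)) : ℝ) : ℂ))
    (fun k : ℝ => (2 * a / (k ^ 2 + a ^ 2) : ℂ)) (by fun_prop) hint hi ?_ x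
  · rw [abs_of_pos hx] at hinv
    have h2 : (2 * Real.pi : ℂ) ≠ 0 := by simp [Real.pi_ne_zero]
    have e : Complex.exp (-(x * a)) = ((Real.exp (-(a * x)) : ℝ) : ℂ) := by push_cast; ring_nf
    rw [e, hinv, ← mul_assoc]
    have h3 : (2 * Real.pi : ℂ) * ((1 / (2 * Real.pi) : ℝ) : ℂ) = 1 := by
      push_cast
      exact mul_one_div_cancel h2
    rw [h3, one_mul]
  · intro k
    have e1 : ∫ y : ℝ in Ioi 0, Complex.exp (Complex.I * k * y) * ((Real.exp (-(a * |y|)) : ℝ) : ℂ)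
        = 1 / (a - Complex.I * k) := by
      have := integral_exp_mul_complex_Ioi (a := -a + Complex.I * k) (by simpa using ha) 0
      rw [setIntegral_congr_fun (g := fun y : ℝ => Complex.exp ((-a + Complex.I * k) * y))
        measurableSet_Ioi, this]
      · rw [← neg_div_neg_eq]; simp
        ring
      · intro y hy
        simp only [abs_of_pos (mem_Ioi.1 hy)]
        push_cast
        rw [← Complex.exp_add]
        ring_nf
    have e2 : ∫ y : ℝ in Iic 0, Complex.exp (Complex.I * k * y) * ((Real.exp (-(a * |y|)) : ℝ) : ℂ)
        = 1 / (a + Complex.I * k) := by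
      have h0 := integral_comp_neg_Ioi (0:ℝ)
        (fun y : ℝ => Complex.exp (Complex.I * k * y) * ((Real.exp (-(a * |y|)) : ℝ) : ℂ))
      rw [neg_zero] at h0
      rw [← h0]
      have := integral_exp_mul_complex_Ioi (a := -a - Complex.I * k) (by simpa using ha) 0
      rw [setIntegral_congr_fun (g := fun y : ℝ => Complex.exp ((-a - Complex.I * k) * y))
        measurableSet_Ioi, this]
      · rw [← neg_div_neg_eq]; simp
        ring
      · intro y hy
        simp only [abs_neg, abs_of_pos (mem_Ioi.1 hy)]
        push_cast
        rw [← Complex.exp_add]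
        ring_nf
    have hI : Integrable (fun y : ℝ => Complex.exp (Complex.I * k * y) *
        ((Real.exp (-(a * |y|)) : ℝ) : ℂ)) := by
      refine hint.bdd_mul (c := 1) (Continuous.aestronglyMeasurable (by fun_prop)) ?_
      refine Filter.Eventually.of_forall fun y => ?_
      rw [show Complex.I * k * y = ((k * y : ℝ) : ℂ) * Complex.I by push_cast; ring,
        Complex.norm_exp_ofReal_mul_I]
    rw [← setIntegral_univ, ← Iic_union_Ioi (a := (0:ℝ)),
      setIntegral_union (Iic_disjoint_Ioi le_rfl) measurableSet_Ioi hI.integrableOn hI.integrableOn,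
      e1, e2]
    have n1 : (a + Complex.I * k : ℂ) ≠ 0 := by
      intro h; have := congrArg Complex.re h; simp at this; linarith
    have n2 : (a - Complex.I * k : ℂ) ≠ 0 := by
      intro h; have := congrArg Complex.re h; simp at this; linarith
    have n3 : (k ^ 2 + a ^ 2 : ℂ) = (a + Complex.I * k) * (a - Complex.I * k) := by
      linear_combination (k ^ 2 : ℂ) * Complex.I_sq
    rw [n3]
    field_simp
    ring

lemma aux_res_integrable (α s : ℝ) (hα : 1 < α ∧ α < 2) (hs : 0 < s) :
    Integrable (fun k : ℝ => 1 / ((s : ℂ) - ((k : ℂ) * Complex.I) ^ (α : ℂ))) := by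
  have hc : 0 < |Real.cos (α * Real.pi / 2)| := abs_pos.2 (aux_cos α hα).ne
  have hre : ∀ k : ℝ, ((s : ℂ) - ((k : ℂ) * Complex.I) ^ (α : ℂ)).re =
      s + |Real.cos (α * Real.pi / 2)| * |k| ^ α := by
    intro k
    rw [Complex.sub_re, aux_cpow_re α k hα, Complex.ofReal_re]; ring
  have hpos : ∀ k : ℝ, 0 < s + |Real.cos (α * Real.pi / 2)| * |k| ^ α := by
    intro k; positivity
  refine (aux_integrable s _ α hs hc hα.1).mono' ?_ (Filter.Eventually.of_forall fun k => ?_)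
  · apply Continuous.aestronglyMeasurable
    refine Continuous.div continuous_const (continuous_const.sub (aux_cont α hα)) ?_
    intro k h
    have := hre k
    rw [h] at this
    simp only [Complex.zero_re] at this
    linarith [hpos k]
  · rw [norm_div, norm_one]
    apply one_div_le_one_div_of_le (hpos k)
    rw [← hre k]
    exact Complex.re_le_norm _

lemma aux_H (α s : ℝ) (hα : 1 < α ∧ α < 2) (hs : 0 < s) :
    ∃ H : ℂ → ℂ, ContinuousOn H {z | 0 ≤ z.re} ∧ DifferentiableOn ℂ H {z | 0 < z.re} ∧
      ∀ z : ℂ, 0 ≤ z.re → z ≠ ((s ^ (1 / α) : ℝ) : ℂ) →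
        H z = 1 / (s - z ^ (α : ℂ)) + ((1 / α * s ^ (-1 + 1 / α) : ℝ) : ℂ) *
          (2 * ((s ^ (1 / α) : ℝ) : ℂ)) / (z ^ 2 - ((s ^ (1 / α) : ℝ) : ℂ) ^ 2) := by
  obtain ⟨a, ha⟩ : ∃ a : ℝ, a = s ^ (1 / α) := ⟨_, rfl⟩
  obtain ⟨c, hc⟩ : ∃ c : ℝ, c = 1 / α * s ^ (-1 + 1 / α) := ⟨_, rfl⟩
  have hα0 : 0 < α := by linarith
  have ha0 : 0 < a := by rw [ha]; positivity
  have hc0 : 0 < c := by rw [hc]; positivity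
  have has : a ^ α = s := by
    rw [ha, ← Real.rpow_mul hs.le, one_div_mul_cancel hα0.ne', Real.rpow_one]
  have hac : c * (α * a ^ (α - 1)) = 1 := by
    rw [hc, ha, ← Real.rpow_mul hs.le]
    have : s ^ (-1 + 1 / α) * s ^ (1 / α * (α - 1)) = 1 := by
      rw [← Real.rpow_add hs]
      have : -1 + 1 / α + 1 / α * (α - 1) = 0 := by field_simp; ring
      rw [this, Real.rpow_zero]
    calc _ = (1 / α * α) * (s ^ (-1 + 1 / α) * s ^ (1 / α * (α - 1))) := by ring
      _ = 1 := by rw [this, one_div_mul_cancel hα0.ne', one_mul]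
  rw [← ha, ← hc]
  have hasC : (a : ℂ) ^ (α : ℂ) = s := by
    rw [← Complex.ofReal_cpow ha0.le, has]
  have hopen : IsOpen {z : ℂ | 0 < z.re} := isOpen_lt continuous_const Complex.continuous_re
  have hU : {z : ℂ | 0 < z.re} ∈ nhds (a : ℂ) := hopen.mem_nhds (by simpa using ha0)
  have hUc : {z : ℂ | 0 ≤ z.re} ∈ nhds (a : ℂ) :=
    Filter.mem_of_superset hU fun z (hz : 0 < z.re) => (hz.le : 0 ≤ z.re)
  have hPd : DifferentiableOn ℂ (fun z : ℂ => z ^ (α : ℂ)) {z | 0 < z.re} := by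
    intro z hz
    exact (DifferentiableAt.cpow_const differentiableAt_id (Or.inl hz)).differentiableWithinAt
  have hPc : ContinuousOn (fun z : ℂ => z ^ (α : ℂ)) {z | 0 ≤ z.re} := by
    intro z hz
    exact (Complex.continuousAt_cpow_const_of_re_pos (Or.inl hz)
      (by simpa using hα0)).continuousWithinAt
  obtain ⟨φ, hφ⟩ : ∃ φ : ℂ → ℂ, φ = dslope (fun z : ℂ => z ^ (α : ℂ)) a := ⟨_, rfl⟩
  have hφd : DifferentiableOn ℂ φ {z | 0 < z.re} := by
    rw [hφ]; exact (Complex.differentiableOn_dslope hU).2 hPd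
  have hφc : ContinuousOn φ {z | 0 ≤ z.re} := by
    rw [hφ]; exact (continuousOn_dslope hUc).2 ⟨hPc, hPd.differentiableAt hU⟩
  have hφa : φ a = ((α * a ^ (α - 1) : ℝ) : ℂ) := by
    rw [hφ, dslope_same]
    have := (hasDerivAt_id (a : ℂ)).cpow_const (c := (α : ℂ)) (Or.inl (by simpa using ha0))
    simp only [id, mul_one] at this
    rw [HasDerivAt.deriv this]
    push_cast
    rw [Complex.ofReal_cpow ha0.le]
    push_cast
    rfl
  have hφz : ∀ z : ℂ, z ≠ a → φ z = (z ^ (α : ℂ) - s) / (z - a) := by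
    intro z hz
    rw [hφ, dslope_of_ne _ hz, slope_def_field, hasC]
  have hφ0 : ∀ z : ℂ, 0 ≤ z.re → φ z ≠ 0 := by
    intro z hz
    by_cases h : z = a
    · rw [h, hφa]
      have : 0 < α * a ^ (α - 1) := by positivity
      exact_mod_cast this.ne'
    · rw [hφz z h]
      refine div_ne_zero ?_ (sub_ne_zero.2 h)
      intro h0
      apply h
      rw [ha]
      exact aux_root α s hα hs z hz (sub_eq_zero.1 h0)
  have hza : ∀ z : ℂ, 0 ≤ z.re → z + a ≠ 0 := by
    intro z hz h
    have := congrArg Complex.re h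
    simp at this
    linarith
  obtain ⟨N, hN⟩ : ∃ N : ℂ → ℂ, N = fun z => -(φ z)⁻¹ + c * (2 * a) / (z + a) := ⟨_, rfl⟩
  have hNa : N a = 0 := by
    rw [hN]
    simp only
    have h1 : (c : ℂ) * φ a = 1 := by rw [hφa]; exact_mod_cast hac
    have h2 : (φ a)⁻¹ = c := (eq_inv_of_mul_eq_one_left h1).symm
    have h3 : (a : ℂ) ≠ 0 := by exact_mod_cast ha0.ne'
    rw [h2]
    field_simp
    ring
  have hNd : DifferentiableOn ℂ N {z | 0 < z.re} := by
    rw [hN]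
    refine DifferentiableOn.add (hφd.inv fun z hz => hφ0 z (le_of_lt hz)).neg ?_
    exact DifferentiableOn.div (by fun_prop) (by fun_prop) fun z hz => hza z (le_of_lt hz)
  have hNc : ContinuousOn N {z | 0 ≤ z.re} := by
    rw [hN]
    refine ContinuousOn.add (hφc.inv₀ fun z hz => hφ0 z hz).neg ?_
    exact ContinuousOn.div (by fun_prop) (by fun_prop) fun z hz => hza z hz
  refine ⟨dslope N a, (continuousOn_dslope hUc).2 ⟨hNc, hNd.differentiableAt hU⟩,
    (Complex.differentiableOn_dslope hU).2 hNd, ?_⟩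
  intro z hz hne
  rw [dslope_of_ne _ hne, slope_def_field, hNa, sub_zero, hN]
  simp only
  rw [hφz z hne]
  have n1 : z - a ≠ 0 := sub_ne_zero.2 hne
  have n2 := hza z hz
  have n3 : (s : ℂ) - z ^ (α : ℂ) ≠ 0 := by
    intro h
    apply hne
    rw [ha]
    exact aux_root α s hα hs z hz (sub_eq_zero.1 h).symm
  have n4 : z ^ (α : ℂ) - (s : ℂ) ≠ 0 := by
    intro h; apply n3; linear_combination -h
  rw [show z ^ 2 - (a : ℂ) ^ 2 = (z - a) * (z + a) by ring,
    show (s : ℂ) - z ^ (α : ℂ) = -(z ^ (α : ℂ) - s) by ring]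
  field_simp

lemma aux_contour (α s x : ℝ) (hα : 1 < α ∧ α < 2) (hs : 0 < s) (hx : 0 < x) :
    ∫ k : ℝ, Complex.exp (-(k * Complex.I * x)) * (1 / ((s : ℂ) - ((k : ℂ) * Complex.I) ^ (α : ℂ)))
      = ((2 * Real.pi * ((1 / α) * s ^ (-1 + 1 / α) * Real.exp (-(x * s ^ (1 / α)))) : ℝ) : ℂ) := by
  obtain ⟨H, Hc, Hd, hH⟩ := aux_H α s hα hs
  have hα0 : 0 < α := by linarith
  obtain ⟨a, ha⟩ : ∃ a : ℝ, a = s ^ (1 / α) := ⟨_, rfl⟩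
  obtain ⟨c, hc⟩ : ∃ c : ℝ, c = 1 / α * s ^ (-1 + 1 / α) := ⟨_, rfl⟩
  have ha0 : 0 < a := by rw [ha]; positivity
  have hc0 : 0 < c := by rw [hc]; positivity
  have has : a ^ α = s := by
    rw [ha, ← Real.rpow_mul hs.le, one_div_mul_cancel hα0.ne', Real.rpow_one]
  rw [← ha, ← hc] at hH ⊢
  have hHk : ∀ k : ℝ, H (k * Complex.I) = 1 / ((s : ℂ) - ((k : ℂ) * Complex.I) ^ (α : ℂ))
      - c * (2 * a / (k ^ 2 + a ^ 2)) := by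
    intro k
    rw [hH _ (by simp) (by
      intro h; have := congrArg Complex.re h; simp at this; linarith)]
    have : ((k : ℂ) * Complex.I) ^ 2 - (a : ℂ) ^ 2 = -(k ^ 2 + a ^ 2) := by
      rw [mul_pow, Complex.I_sq]; ring
    rw [this, div_neg]
    ring
  have hexp : ∀ z : ℂ, 0 ≤ z.re → ‖Complex.exp (-(z * x))‖ ≤ 1 := by
    intro z hz
    rw [Complex.norm_exp]
    simp only [Complex.neg_re, Complex.re_mul_ofReal]
    apply Real.exp_le_one_iff.2
    nlinarith
  have hexpk : ∀ k : ℝ, ‖Complex.exp (-(k * Complex.I * x))‖ ≤ 1 := fun k => hexp _ (by simp)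
  have hI1 : Integrable (fun k : ℝ => Complex.exp (-(k * Complex.I * x)) *
      (1 / ((s : ℂ) - ((k : ℂ) * Complex.I) ^ (α : ℂ)))) :=
    (aux_res_integrable α s hα hs).bdd_mul (c := 1)
      (Continuous.aestronglyMeasurable (by fun_prop)) (Filter.Eventually.of_forall hexpk)
  have hI2 : Integrable (fun k : ℝ => Complex.exp (-(k * Complex.I * x)) *
      (2 * a / (k ^ 2 + a ^ 2) : ℂ)) := by
    have hi : Integrable (fun k : ℝ => (2 * a / (k ^ 2 + a ^ 2) : ℂ)) := by
      have h := ((aux_integrable (a ^ 2) 1 2 (by positivity) one_pos (by norm_num)).const_mul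
        (2 * a)).ofReal (𝕜 := ℂ)
      refine h.congr (Filter.Eventually.of_forall fun k => ?_)
      simp [div_eq_mul_inv, add_comm]
    exact hi.bdd_mul (c := 1)
      (Continuous.aestronglyMeasurable (by fun_prop)) (Filter.Eventually.of_forall hexpk)
  have hsplit : (fun k : ℝ => Complex.exp (-(k * Complex.I * x)) * H (k * Complex.I)) =
      fun k : ℝ => Complex.exp (-(k * Complex.I * x)) *
      (1 / ((s : ℂ) - ((k : ℂ) * Complex.I) ^ (α : ℂ))) -
      c * (Complex.exp (-(k * Complex.I * x)) * (2 * a / (k ^ 2 + a ^ 2) : ℂ)) := by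
    ext k
    rw [hHk]; ring
  have hzero := aux_half_plane (fun z => Complex.exp (-(z * x)) * H z)
    (ContinuousOn.mul (by fun_prop) Hc) (DifferentiableOn.mul (by fun_prop) Hd)
    (2 + 4 * c * a) α (max 1 (2 * a)) (by positivity) hα.1 ?_ ?_
  · rw [hsplit, integral_sub hI1 (hI2.const_mul _), integral_const_mul, aux_exp a x ha0 hx,
      sub_eq_zero] at hzero
    rw [hzero]
    push_cast
    ring
  · intro z hz hzR
    have hz1 : 1 ≤ ‖z‖ := (le_max_left _ _).trans hzR
    have hz2 : 2 * a ≤ ‖z‖ := (le_max_right _ _).trans hzR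
    have hz0 : 0 < ‖z‖ := by linarith
    have hne : z ≠ a := by
      intro h
      rw [h, Complex.norm_real, Real.norm_eq_abs, abs_of_pos ha0] at hz2
      linarith
    have hza : 0 < ‖z‖ ^ α := by positivity
    have b1 : ‖z‖ ^ α / 2 ≤ ‖(s : ℂ) - z ^ (α : ℂ)‖ := by
      have h1 : 2 * s ≤ ‖z‖ ^ α := by
        calc 2 * s ≤ 2 ^ α * a ^ α := by
              rw [has]
              have : (2:ℝ) ^ (1:ℝ) ≤ 2 ^ α := Real.rpow_le_rpow_of_exponent_le (by norm_num) hα.1.le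
              rw [Real.rpow_one] at this
              nlinarith
          _ = (2 * a) ^ α := (Real.mul_rpow (by norm_num) ha0.le).symm
          _ ≤ _ := Real.rpow_le_rpow (by positivity) hz2 hα0.le
      have h2 := norm_sub_norm_le (z ^ (α : ℂ)) (s : ℂ)
      rw [norm_sub_rev, Complex.norm_cpow_real, Complex.norm_real, Real.norm_eq_abs,
        abs_of_pos hs] at h2
      linarith
    have b2 : ‖z‖ ^ α / 2 ≤ ‖z ^ 2 - (a : ℂ) ^ 2‖ := by
      have h1 : ‖z‖ ^ α ≤ ‖z‖ ^ 2 := by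
        rw [← Real.rpow_two]
        exact Real.rpow_le_rpow_of_exponent_le hz1 hα.2.le
      have h2 := norm_sub_norm_le (z ^ 2) ((a : ℂ) ^ 2)
      rw [norm_pow, norm_pow, Complex.norm_real, Real.norm_eq_abs, abs_of_pos ha0] at h2
      nlinarith
    rw [norm_mul]
    calc _ ≤ 1 * ‖H z‖ := mul_le_mul_of_nonneg_right (hexp z hz) (norm_nonneg _)
      _ = ‖H z‖ := one_mul _
      _ ≤ 1 / (‖z‖ ^ α / 2) + c * (2 * a) / (‖z‖ ^ α / 2) := by
          rw [hH z hz hne]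
          refine (norm_add_le _ _).trans (add_le_add ?_ ?_)
          · rw [norm_div, norm_one]
            exact one_div_le_one_div_of_le (by positivity) b1
          · rw [norm_div]
            have : ‖(c : ℂ) * (2 * (a : ℂ))‖ = c * (2 * a) := by
              rw [norm_mul, norm_mul, Complex.norm_real, Complex.norm_real, Real.norm_eq_abs,
                Real.norm_eq_abs, abs_of_pos ha0, abs_of_pos hc0]
              simp
            rw [this]
            exact div_le_div_of_nonneg_left (by positivity) (by positivity) b2
      _ = _ := by
          rw [Real.rpow_neg hz0.le]
          field_simp
          ring
  · rw [hsplit]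
    exact hI1.sub (hI2.const_mul _)

lemma aux_stableCF (α t k : ℝ) (hα : 1 < α ∧ α < 2) (ht : 0 < t) :
    stableCF α (-1) ((|Real.cos (α * Real.pi / 2)| * t) ^ (1 / α)) 0 k =
      Complex.exp (t * ((k : ℂ) * Complex.I) ^ (α : ℂ)) := by
  have hc := aux_cos α hα
  have hα0 : 0 < α := by linarith
  rw [stableCF, aux_cpow α k hα, ← Real.rpow_mul (by positivity), one_div_mul_cancel hα0.ne',
    Real.rpow_one, abs_of_neg hc, Real.tan_eq_sin_div_cos]
  have hcC : (Real.cos (α * Real.pi / 2) : ℂ) ≠ 0 := by exact_mod_cast hc.ne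
  congr 1
  simp only [Complex.ofReal_mul, Complex.ofReal_neg, Complex.ofReal_div, Complex.ofReal_zero,
    Complex.ofReal_one]
  field_simp
  ring

lemma aux_fubini (α s x : ℝ) (hα : 1 < α ∧ α < 2) (hs : 0 < s) :
    ∫ t in Ioi (0 : ℝ), ∫ k : ℝ, Complex.exp (-(k * Complex.I * x)) *
        Complex.exp ((((k : ℂ) * Complex.I) ^ (α : ℂ) - s) * t) =
      ∫ k : ℝ, Complex.exp (-(k * Complex.I * x)) *
        (1 / ((s : ℂ) - ((k : ℂ) * Complex.I) ^ (α : ℂ))) := by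
  have hc : 0 < |Real.cos (α * Real.pi / 2)| := abs_pos.2 (aux_cos α hα).ne
  have hre : ∀ k : ℝ, (((k : ℂ) * Complex.I) ^ (α : ℂ) - s).re =
      -(s + |Real.cos (α * Real.pi / 2)| * |k| ^ α) := by
    intro k
    rw [Complex.sub_re, aux_cpow_re α k hα, Complex.ofReal_re]; ring
  have hpos : ∀ k : ℝ, 0 < s + |Real.cos (α * Real.pi / 2)| * |k| ^ α := by
    intro k; positivity
  have hneg : ∀ k : ℝ, (((k : ℂ) * Complex.I) ^ (α : ℂ) - s).re < 0 := by
    intro k; rw [hre]; linarith [hpos k]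
  have hnorm : ∀ k : ℝ, ‖Complex.exp (-(k * Complex.I * x))‖ = 1 := by
    intro k
    rw [show -((k : ℂ) * Complex.I * x) = ((-(k * x) : ℝ) : ℂ) * Complex.I by push_cast; ring,
        Complex.norm_exp_ofReal_mul_I]
  have hcont := aux_cont α hα
  have hswap := integral_integral_swap (μ := volume.restrict (Ioi (0:ℝ))) (ν := volume)
    (f := fun t k : ℝ => Complex.exp (-(k * Complex.I * x)) *
        Complex.exp ((((k : ℂ) * Complex.I) ^ (α : ℂ) - s) * t)) ?_
  · rw [hswap]
    congr 1; ext k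
    rw [integral_const_mul, integral_exp_mul_complex_Ioi (hneg k) 0]
    congr 1
    rw [← neg_div_neg_eq]
    simp
  · have hcont2 : Continuous (fun q : ℝ × ℝ => ((q.2 : ℂ) * Complex.I) ^ (α : ℂ)) :=
      hcont.comp continuous_snd
    rw [integrable_prod_iff']
    · constructor
      · refine Filter.Eventually.of_forall fun k => ?_
        exact Integrable.const_mul (integrableOn_exp_mul_complex_Ioi (hneg k) 0)
          (Complex.exp (-(k * Complex.I * x)))
      · refine (aux_integrable s _ α hs hc hα.1).congr (Filter.Eventually.of_forall fun k => ?_)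
        simp only [Function.uncurry]
        have : ∀ t : ℝ, ‖Complex.exp (-(k * Complex.I * x)) *
            Complex.exp ((((k : ℂ) * Complex.I) ^ (α : ℂ) - s) * t)‖ =
            Real.exp (-(s + |Real.cos (α * Real.pi / 2)| * |k| ^ α) * t) := by
          intro t
          rw [norm_mul, hnorm, one_mul, Complex.norm_exp, Complex.re_mul_ofReal, hre]
        simp only [this]
        rw [integral_exp_mul_Ioi (by linarith [hpos k]) 0, mul_zero, Real.exp_zero, neg_div_neg_eq]
    · apply Continuous.aestronglyMeasurable
      simp only [Function.uncurry_def]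
      fun_prop

/-- The Laplace transform in time of the negatively skewed stable density
`p(x,t) = g(x; α, −1, (|cos(απ/2)| t)^{1/α}, 0)` is `(1/α) s^{−1+1/α} exp(−x s^{1/α})`
for `x > 0`, `s > 0`. -/
theorem laplace_transform_neg_skewed_stable
    (α : ℝ) (hα : 1 < α ∧ α < 2)
    (g : ℝ → ℝ → ℝ → ℝ → ℝ → ℝ)
    (hg : ∀ a β σ v : ℝ, (0 < a ∧ a < 2 ∧ a ≠ 1) → (-1 ≤ β ∧ β ≤ 1) → 0 < σ →
      IsStableDensity a β σ v (fun x => g x a β σ v))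
    (p : ℝ → ℝ → ℝ)
    (hp : ∀ x t : ℝ, p x t
      = g x α (-1) ((|Real.cos (α * Real.pi / 2)| * t) ^ (1 / α)) 0)
    (x s : ℝ) (hx : 0 < x) (hs : 0 < s) :
    ∫ t in Set.Ioi (0 : ℝ), Real.exp (-(s * t)) * p x t
      = (1 / α) * s ^ (-1 + 1 / α) * Real.exp (-(x * s ^ (1 / α))) := by
  have hc : 0 < |Real.cos (α * Real.pi / 2)| := abs_pos.2 (aux_cos α hα).ne
  have hpt : ∀ t ∈ Ioi (0 : ℝ), ((Real.exp (-(s * t)) * p x t : ℝ) : ℂ) =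
      (1 / (2 * Real.pi) : ℝ) * ∫ k : ℝ, Complex.exp (-(k * Complex.I * x)) *
        Complex.exp ((((k : ℂ) * Complex.I) ^ (α : ℂ) - s) * t) := by
    intro t ht
    have ht : 0 < t := ht
    obtain ⟨h1, h2, h3⟩ := hg α (-1) ((|Real.cos (α * Real.pi / 2)| * t) ^ (1 / α)) 0
      ⟨by linarith, hα.2, by linarith⟩ (by norm_num) (by positivity)
    have hφ : Integrable (fun k : ℝ => Complex.exp (t * ((k : ℂ) * Complex.I) ^ (α : ℂ))) := by
      refine (aux_integrable 1 (t * |Real.cos (α * Real.pi / 2)|) α one_pos (by positivity)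
        hα.1).mono' ?_ (Filter.Eventually.of_forall fun k => ?_)
      · have := aux_cont α hα
        exact Continuous.aestronglyMeasurable (by fun_prop)
      · rw [Complex.norm_exp, Complex.re_ofReal_mul, aux_cpow_re α k hα, mul_neg, Real.exp_neg,
          ← one_div, mul_assoc]
        apply one_div_le_one_div_of_le (by positivity)
        linarith [Real.add_one_le_exp (t * (|Real.cos (α * Real.pi / 2)| * |k| ^ α))]
    have hinv := aux_inversion
      (fun y => (g y α (-1) ((|Real.cos (α * Real.pi / 2)| * t) ^ (1 / α)) 0 : ℂ))
      (fun k : ℝ => Complex.exp (t * ((k : ℂ) * Complex.I) ^ (α : ℂ)))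
      (Complex.continuous_ofReal.comp h1) h2.ofReal hφ
      (fun k => (h3 k).trans (aux_stableCF α t k hα ht)) x
    rw [hp, Complex.ofReal_mul, hinv, mul_left_comm, ← integral_const_mul]
    congr 2; ext k
    rw [Complex.ofReal_exp, ← Complex.exp_add, ← Complex.exp_add, ← Complex.exp_add]
    congr 1
    push_cast
    ring
  apply Complex.ofReal_injective
  rw [← integral_complex_ofReal, setIntegral_congr_fun measurableSet_Ioi hpt, integral_const_mul,
    aux_fubini α s x hα hs, aux_contour α s x hα hs hx, ← Complex.ofReal_mul]
  congr 1
  field_simp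
end

section
/- Let α ∈ (1,2) and define h(x,t) = α·t·x^{−1−α}·g(t·x^{−α}; 1/α, 1, |cos(π/(2α))|^α, 0) for x > 0, t > 0, where g denotes the stable density. Then for all x > 0 and s > 0: ∫_0^∞ e^{−st} h(x,t) dt = s^{−1+1/α}·exp(−x·s^{1/α}). -/
open MeasureTheory Set

open scoped FourierTransform

lemma lap_integrable (l : ℝ) (hl : 0 < l) :
    IntegrableOn (fun u : ℝ => u * Real.exp (-(l * u))) (Ioi 0) := by
  have := integrableOn_rpow_mul_exp_neg_mul_rpow (p := 1) (s := 1) (b := l) (by norm_num) one_pos hl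
  simpa using this

lemma lap_integral (b : ℂ) (hb : 0 < b.re) :
    ∫ u in Ioi (0:ℝ), (u : ℂ) * Complex.exp (-(b * u)) = 1 / b ^ 2 := by
  have hb0 : b ≠ 0 := by rintro rfl; simp at hb
  have hderiv : ∀ x ∈ Ici (0:ℝ), HasDerivAt
      (fun u : ℝ => -((u : ℂ) / b + 1 / b ^ 2) * Complex.exp (-(b * u)))
      ((x : ℂ) * Complex.exp (-(b * x))) x := by
    intro x _
    have h1 : HasDerivAt (fun u : ℝ => (u : ℂ)) 1 x := Complex.ofRealCLM.hasDerivAt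
    have h2 := (((h1.div_const b).add_const (1 / b ^ 2)).neg).mul ((h1.const_mul b).neg.cexp)
    convert! h2 using 1
    simp only [Pi.neg_apply]
    field_simp
    ring
  have hint : IntegrableOn (fun u : ℝ => (u : ℂ) * Complex.exp (-(b * u))) (Ioi 0) := by
    refine Integrable.mono' (lap_integrable b.re hb) (by fun_prop) ?_
    filter_upwards [ae_restrict_mem measurableSet_Ioi] with u hu
    simp [Complex.norm_exp, abs_of_pos (show 0 < u from hu)]
  have htend : Filter.Tendsto (fun u : ℝ => -((u : ℂ) / b + 1 / b ^ 2) * Complex.exp (-(b * u)))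
      Filter.atTop (nhds 0) := by
    have e1 : Filter.Tendsto (fun u : ℝ => u * Real.exp (-(b.re * u))) Filter.atTop (nhds 0) := by
      have := Real.tendsto_pow_mul_exp_neg_atTop_nhds_zero 1
      have h3 := (this.comp (Filter.tendsto_id.const_mul_atTop hb)).const_mul (b.re)⁻¹
      rw [mul_zero] at h3
      refine h3.congr (fun u => ?_)
      simp only [Function.comp, id, pow_one]; field_simp
    have e2 : Filter.Tendsto (fun u : ℝ => Real.exp (-(b.re * u))) Filter.atTop (nhds 0) :=
      Real.tendsto_exp_neg_atTop_nhds_zero.comp (Filter.tendsto_id.const_mul_atTop hb)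
    have e3 := (e1.const_mul ‖1 / b‖).add (e2.const_mul ‖1 / b ^ 2‖)
    simp only [mul_zero, add_zero] at e3
    refine squeeze_zero_norm' ?_ e3
    filter_upwards [Filter.eventually_ge_atTop 0] with u hu
    rw [norm_mul, norm_neg, Complex.norm_exp]
    have : (-(b * (u:ℂ))).re = -(b.re * u) := by simp
    rw [this, ← mul_assoc, ← add_mul]
    gcongr
    refine (norm_add_le _ _).trans ?_
    gcongr
    rw [div_eq_mul_inv, norm_mul, one_div, mul_comm]
    simp [abs_of_nonneg hu]
  have := integral_Ioi_of_hasDerivAt_of_tendsto' hderiv hint htend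
  rw [this]; simp

noncomputable def lapF (l : ℝ) (u : ℝ) : ℂ := ((max u 0 * Real.exp (-(l * u)) : ℝ) : ℂ)

lemma lapF_cont (l : ℝ) : Continuous (lapF l) := by
  unfold lapF; fun_prop

lemma lapF_indicator (l : ℝ) : lapF l = (Ioi (0:ℝ)).indicator
    (fun u => ((u * Real.exp (-(l * u)) : ℝ) : ℂ)) := by
  ext u
  by_cases hu : 0 < u
  · simp [lapF, hu, hu.le]
  · simp [lapF, hu, not_lt.1 hu]

lemma lapF_int (l : ℝ) (hl : 0 < l) : Integrable (lapF l) := by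
  rw [lapF_indicator, integrable_indicator_iff measurableSet_Ioi]
  exact (lap_integrable l hl).ofReal

lemma lapF_fourier (l : ℝ) (hl : 0 < l) (w : ℝ) :
    𝓕 (lapF l) w = 1 / ((l : ℂ) + 2 * Real.pi * w * Complex.I) ^ 2 := by
  rw [Real.fourier_real_eq_integral_exp_smul, ← lap_integral _ (by simpa using hl),
    ← integral_indicator measurableSet_Ioi]
  congr 1
  ext u
  rw [lapF_indicator]
  by_cases hu : 0 < u
  · simp only [mem_Ioi, hu, indicator_of_mem, smul_eq_mul]
    push_cast
    rw [mul_left_comm, ← Complex.exp_add]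
    congr 2; ring
  · simp [hu]

lemma lapF_fourier_int (l : ℝ) (hl : 0 < l) : Integrable (𝓕 (lapF l)) := by
  have h0 : ∀ w : ℝ, (l : ℂ) + 2 * Real.pi * w * Complex.I ≠ 0 := by
    intro w h
    have := congrArg Complex.re h
    simp at this; exact hl.ne' this
  have h1 : Integrable (fun w : ℝ => (l ^ 2)⁻¹ * (1 + ((2 * Real.pi / l) * w) ^ 2)⁻¹) :=
    (integrable_inv_one_add_sq.comp_mul_left' (by positivity)).const_mul _
  refine h1.mono' ?_ ?_
  · rw [funext (lapF_fourier l hl)]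
    refine (Continuous.div (by fun_prop) (by fun_prop) ?_).aestronglyMeasurable
    intro w; exact pow_ne_zero _ (h0 w)
  · refine Filter.Eventually.of_forall fun w => ?_
    rw [lapF_fourier l hl, norm_div, norm_pow, norm_one, ← Complex.normSq_eq_norm_sq,
      Complex.normSq_apply]
    simp
    rw [← mul_inv]
    apply le_of_eq
    congr 1
    field_simp

lemma lapF_duality (l : ℝ) (hl : 0 < l) (g : ℝ → ℂ) (hg : Integrable g) :
    ∫ u, lapF l u * g u = ∫ w : ℝ, 1 / ((l : ℂ) - 2 * Real.pi * w * Complex.I) ^ 2 * 𝓕 g w := by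
  have hF := (lapF_cont l).fourier_fourierInv_eq (lapF_int l hl) (lapF_fourier_int l hl)
  have hI : Integrable (𝓕⁻ (lapF l)) := by
    have := (lapF_fourier_int l hl).comp_neg
    refine this.congr (Filter.Eventually.of_forall fun w => ?_)
    rw [Real.fourierInv_eq_fourier_neg]
  have hfin := VectorFourier.integral_fourierIntegral_smul_eq_flip (μ := volume) (ν := volume)
    (L := innerₗ ℝ) Real.continuous_fourierChar continuous_inner hI hg
  rw [flip_innerₗ] at hfin
  have hfin' : ∫ u, (𝓕 (𝓕⁻ (lapF l))) u • g u = ∫ w, (𝓕⁻ (lapF l)) w • 𝓕 g w := hfin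
  rw [hF] at hfin'
  simp only [smul_eq_mul] at hfin'
  rw [hfin']
  congr 1; ext w
  rw [Real.fourierInv_eq_fourier_neg, lapF_fourier l hl]
  push_cast
  ring_nf

lemma re_cpow_ge (a : ℝ) (ha : 0 < a) (ha1 : a < 1) (z : ℂ) (hz : 0 ≤ z.re) :
    ‖z‖ ^ a * Real.cos (a * Real.pi / 2) ≤ (z ^ (a : ℂ)).re := by
  by_cases h0 : z = 0
  · subst h0
    have : (a : ℂ) ≠ 0 := by exact_mod_cast ha.ne'
    simp [this, Real.zero_rpow ha.ne']
  have harg : |Complex.arg z| ≤ Real.pi / 2 := Complex.abs_arg_le_pi_div_two_iff.2 hz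
  rw [Complex.cpow_ofReal_re]
  gcongr
  rw [← Real.cos_abs (_ * _), abs_mul, abs_of_pos ha]
  apply Real.cos_le_cos_of_nonneg_of_le_pi
  · positivity
  · nlinarith [Real.pi_pos]
  · nlinarith [Real.pi_pos]

/-- The Laplace transform of the subordinator, pulled back to the unit disc. -/
noncomputable def discF (a l : ℝ) (w : ℂ) : ℂ :=
  if w = 1 then 0 else Complex.exp (-(((l : ℂ) * ((1 + w) / (1 - w))) ^ (a : ℂ)))

lemma cayley_re (l : ℝ) (w : ℂ) : ((l : ℂ) * ((1 + w) / (1 - w))).re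
    = l * ((1 - ‖w‖ ^ 2) / ‖1 - w‖ ^ 2) := by
  rw [Complex.re_ofReal_mul, Complex.div_re, ← Complex.normSq_eq_norm_sq,
    ← Complex.normSq_eq_norm_sq, ← add_div]
  congr 2
  simp [Complex.normSq_apply]; ring

lemma discF_diff (a l : ℝ) (hl : 0 < l) :
    DifferentiableOn ℂ (discF a l) (Metric.ball 0 1) := by
  have : DifferentiableOn ℂ (fun w : ℂ => Complex.exp (-(((l : ℂ) * ((1 + w) / (1 - w))) ^ (a : ℂ))))
      (Metric.ball 0 1) := by
    intro w hw
    have hw1 : ‖w‖ < 1 := by simpa using hw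
    have hne : 1 - w ≠ 0 := by
      intro h
      have : w = 1 := (sub_eq_zero.1 h).symm
      simp [this] at hw1
    have hn : 0 < ‖1 - w‖ := norm_pos_iff.2 hne
    apply DifferentiableAt.differentiableWithinAt
    apply DifferentiableAt.cexp
    apply DifferentiableAt.neg
    apply DifferentiableAt.cpow_const
    · apply DifferentiableAt.const_mul
      exact DifferentiableAt.div (by fun_prop) (by fun_prop) hne
    · left
      rw [cayley_re]
      have : 0 < 1 - ‖w‖ ^ 2 := by nlinarith [norm_nonneg w]
      positivity
  refine this.congr fun w hw => ?_
  have : w ≠ 1 := by rintro rfl; simp at hw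
  simp [discF, this]

lemma discF_cont (a l : ℝ) (ha : 0 < a) (ha1 : a < 1) (hl : 0 < l) :
    ContinuousOn (discF a l) (Metric.closedBall 0 1) := by
  have hre : ∀ w ∈ Metric.closedBall (0:ℂ) 1, 0 ≤ ((l : ℂ) * ((1 + w) / (1 - w))).re := by
    intro w hw
    have hw1 : ‖w‖ ≤ 1 := by simpa using hw
    rw [cayley_re]
    have : 0 ≤ 1 - ‖w‖ ^ 2 := by nlinarith [norm_nonneg w]
    positivity
  intro w hw
  by_cases hw1 : w = 1
  · subst hw1
    have hc : 0 < Real.cos (a * Real.pi / 2) := by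
      apply Real.cos_pos_of_mem_Ioo
      constructor <;> nlinarith [Real.pi_pos]
    rw [← continuousWithinAt_sdiff_self]
    have h1 : Filter.Tendsto (fun w : ℂ => l * (‖1 + w‖ / ‖1 - w‖)) (nhdsWithin 1 {1}ᶜ)
        Filter.atTop := by
      apply Filter.Tendsto.const_mul_atTop hl
      have e1 : Filter.Tendsto (fun w : ℂ => ‖1 + w‖) (nhdsWithin 1 {1}ᶜ) (nhds ‖(1:ℂ) + 1‖) :=
        (Continuous.tendsto (by fun_prop) _).mono_left nhdsWithin_le_nhds
      have e2 : Filter.Tendsto (fun w : ℂ => ‖1 - w‖) (nhdsWithin 1 {1}ᶜ) (nhdsWithin 0 (Ioi 0)) := by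
        apply tendsto_nhdsWithin_iff.2 ⟨?_, ?_⟩
        · have : Filter.Tendsto (fun w : ℂ => ‖1 - w‖) (nhds 1) (nhds ‖(1:ℂ) - 1‖) :=
            (Continuous.tendsto (by fun_prop) _)
          simp only [sub_self, norm_zero] at this
          exact this.mono_left nhdsWithin_le_nhds
        · filter_upwards [self_mem_nhdsWithin] with w hw
          exact norm_pos_iff.2 (sub_ne_zero.2 (Ne.symm hw))
      exact e1.pos_mul_atTop (by norm_num) e2.inv_tendsto_nhdsGT_zero
    have h2 := Real.tendsto_exp_neg_atTop_nhds_zero.comp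
      (((tendsto_rpow_atTop ha).comp h1).atTop_mul_const hc)
    have h3 := h2.mono_left (nhdsWithin_mono (1:ℂ)
      (show Metric.closedBall (0:ℂ) 1 \ {1} ⊆ {1}ᶜ from fun x hx => hx.2))
    have h4 : discF a l 1 = 0 := by simp [discF]
    rw [ContinuousWithinAt, h4]
    refine squeeze_zero_norm' ?_ h3
    filter_upwards [self_mem_nhdsWithin] with w hw
    have hw' : w ≠ 1 := hw.2
    simp only [discF, hw', if_false, Complex.norm_exp, Complex.neg_re, Function.comp]
    apply Real.exp_le_exp.2
    apply neg_le_neg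
    have := re_cpow_ge a ha ha1 _ (hre w hw.1)
    simpa [abs_of_pos hl] using this
  · have hne : 1 - w ≠ 0 := sub_ne_zero.2 (Ne.symm hw1)
    have : ContinuousAt (fun w : ℂ => Complex.exp (-(((l : ℂ) * ((1 + w) / (1 - w))) ^ (a : ℂ)))) w := by
      apply ContinuousAt.cexp
      apply ContinuousAt.neg
      have h1 : ContinuousAt (fun x : ℂ => x ^ (a : ℂ)) ((l : ℂ) * ((1 + w) / (1 - w))) :=
        Complex.continuousAt_cpow_const_of_re_pos (Or.inl (hre w hw)) (by simpa using ha)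
      have h2 : ContinuousAt (fun w : ℂ => (l : ℂ) * ((1 + w) / (1 - w))) w :=
        continuousAt_const.mul (ContinuousAt.div (by fun_prop) (by fun_prop) hne)
      exact ContinuousAt.comp (f := fun w : ℂ => (l : ℂ) * ((1 + w) / (1 - w))) h1 h2
    apply ContinuousAt.continuousWithinAt
    refine this.congr ?_
    filter_upwards [isOpen_ne.mem_nhds hw1] with v hv
    have hv' : v ≠ 1 := hv
    simp [discF, hv']

lemma discF_deriv (a l : ℝ) (hl : 0 < l) :
    deriv (discF a l) 0 = ((-(2 * a * l ^ a * Real.exp (-(l ^ a))) : ℝ) : ℂ) := by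
  have h1 : HasDerivAt (fun w : ℂ => (l : ℂ) * ((1 + w) / (1 - w))) (l * 2) 0 := by
    have e1 : HasDerivAt (fun w : ℂ => 1 + w) 1 0 := (hasDerivAt_id _).const_add 1
    have e2 : HasDerivAt (fun w : ℂ => 1 - w) (-1) 0 := (hasDerivAt_id _).const_sub 1
    have := (e1.div e2 (by simp)).const_mul (l : ℂ)
    convert! this using 1
    norm_num
  have h2 := (h1.cpow_const (c := (a : ℂ)) (by left; simpa using hl)).neg.cexp
  have h3 : discF a l =ᶠ[nhds 0]
      fun w : ℂ => Complex.exp (-(((l : ℂ) * ((1 + w) / (1 - w))) ^ (a : ℂ))) := by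
    filter_upwards [isOpen_ne.mem_nhds (zero_ne_one : (0:ℂ) ≠ 1)] with v hv
    have hv' : v ≠ 1 := hv
    simp [discF, hv']
  rw [h3.deriv_eq]
  have h2' := h2.deriv
  simp only [Pi.neg_apply, add_zero, sub_zero, div_one, mul_one] at h2'
  refine h2'.trans ?_
  have hl0 : (l : ℂ) ≠ 0 := by exact_mod_cast hl.ne'
  rw [Complex.cpow_sub _ _ hl0, Complex.cpow_one]
  push_cast
  rw [Complex.ofReal_cpow hl.le]
  field_simp

lemma disc_cauchy (a l : ℝ) (ha : 0 < a) (ha1 : a < 1) (hl : 0 < l) :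
    ∫ θ in Ioo 0 (2 * Real.pi), Complex.exp (-(θ * Complex.I)) *
      discF a l (Complex.exp (θ * Complex.I))
      = 2 * Real.pi * ((-(2 * a * l ^ a * Real.exp (-(l ^ a))) : ℝ) : ℂ) := by
  have hd : DiffContOnCl ℂ (discF a l) (Metric.ball 0 ((1 : NNReal) : ℝ)) := by
    refine ⟨by simpa using discF_diff a l hl, ?_⟩
    rw [closure_ball _ (by simp)]
    simpa using discF_cont a l ha ha1 hl
  have := (hd.hasFPowerSeriesOnBall one_pos).hasFPowerSeriesAt.deriv
  rw [discF_deriv a l hl, cauchyPowerSeries_apply] at this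
  rw [this, circleIntegral_def_Icc, ← integral_Icc_eq_integral_Ioo, smul_eq_mul,
    ← integral_const_mul, ← integral_const_mul]
  congr 1; ext θ
  have hpi : (Real.pi : ℂ) ≠ 0 := by exact_mod_cast Real.pi_ne_zero
  simp [circleMap, Complex.exp_neg]
  field_simp
  rw [Complex.I_sq]; ring

lemma line_to_circle (l : ℝ) (hl : 0 < l) (G : ℝ → ℂ) :
    ∫ w : ℝ, G w = ∫ θ in Ioo 0 (2 * Real.pi),
      (l / (4 * Real.pi * Real.sin (θ / 2) ^ 2)) •
        G (l / (2 * Real.pi) * Real.tan (Real.pi / 2 - θ / 2)) := by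
  have hpi := Real.pi_pos
  have himg : (fun θ : ℝ => l / (2 * Real.pi) * Real.tan (Real.pi / 2 - θ / 2)) ''
      Ioo 0 (2 * Real.pi) = univ := by
    apply eq_univ_of_forall
    intro y
    refine ⟨2 * (Real.pi / 2 - Real.arctan (y * (2 * Real.pi) / l)), ⟨?_, ?_⟩, ?_⟩
    · linarith [Real.arctan_lt_pi_div_two (y * (2 * Real.pi) / l)]
    · linarith [Real.neg_pi_div_two_lt_arctan (y * (2 * Real.pi) / l)]
    · have : Real.pi / 2 - 2 * (Real.pi / 2 - Real.arctan (y * (2 * Real.pi) / l)) / 2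
        = Real.arctan (y * (2 * Real.pi) / l) := by ring
      simp only [this, Real.tan_arctan]
      field_simp
  rw [← setIntegral_univ, ← himg, integral_image_eq_integral_abs_deriv_smul
    (f' := fun θ => -(l / (4 * Real.pi * Real.sin (θ / 2) ^ 2))) measurableSet_Ioo]
  · apply setIntegral_congr_fun measurableSet_Ioo
    intro θ hθ
    simp only [abs_neg]
    rw [abs_of_nonneg (by positivity)]
  · intro θ hθ
    apply HasDerivAt.hasDerivWithinAt
    have hs : 0 < Real.sin (θ / 2) := Real.sin_pos_of_pos_of_lt_pi (by linarith [hθ.1]) (by linarith [hθ.2])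
    have hc : Real.cos (Real.pi / 2 - θ / 2) ≠ 0 := by
      rw [Real.cos_pi_div_two_sub]; exact hs.ne'
    have e1 : HasDerivAt (fun θ : ℝ => Real.pi / 2 - θ / 2) (-(1 / 2)) θ :=
      ((hasDerivAt_id θ).div_const 2).const_sub _
    have := ((Real.hasDerivAt_tan hc).comp θ e1).const_mul (l / (2 * Real.pi))
    convert! this using 1
    rw [Real.cos_pi_div_two_sub]
    field_simp
    norm_num
  · intro x hx y hy hxy
    have h1 : Real.tan (Real.pi / 2 - x / 2) = Real.tan (Real.pi / 2 - y / 2) :=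
      mul_left_cancel₀ (by positivity) hxy
    have := Real.injOn_tan ⟨by linarith [hx.2], by linarith [hx.1]⟩
      ⟨by linarith [hy.2], by linarith [hy.1]⟩ h1
    linarith

lemma tan_cayley (θ : ℝ) (hθ : θ ∈ Ioo 0 (2 * Real.pi)) :
    Complex.exp (θ * Complex.I) ≠ 1 ∧
    ((Real.tan (Real.pi / 2 - θ / 2) : ℝ) : ℂ) * Complex.I =
      (1 + Complex.exp (θ * Complex.I)) / (1 - Complex.exp (θ * Complex.I)) ∧
    (1 - ((Real.tan (Real.pi / 2 - θ / 2) : ℝ) : ℂ) * Complex.I) ^ 2 * (Real.sin (θ / 2) : ℂ) ^ 2 =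
      - Complex.exp (θ * Complex.I) := by
  have hs : 0 < Real.sin (θ / 2) :=
    Real.sin_pos_of_pos_of_lt_pi (by linarith [hθ.1]) (by linarith [hθ.2])
  have hs0 : (Real.sin (θ / 2) : ℂ) ≠ 0 := by exact_mod_cast hs.ne'
  have hexp : Complex.exp (θ * Complex.I) =
      ((Real.cos (θ / 2) : ℂ) + Real.sin (θ / 2) * Complex.I) ^ 2 := by
    rw [show (θ : ℂ) * Complex.I = 2 * (((θ / 2 : ℝ) : ℂ) * Complex.I) by push_cast; ring,
      two_mul, Complex.exp_add, Complex.exp_mul_I, ← sq]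
    push_cast; rfl
  have hsq : (Real.sin (θ / 2) : ℂ) ^ 2 + (Real.cos (θ / 2) : ℂ) ^ 2 = 1 := by
    exact_mod_cast Real.sin_sq_add_cos_sq (θ / 2)
  have htan : ((Real.tan (Real.pi / 2 - θ / 2) : ℝ) : ℂ) = Real.cos (θ / 2) / Real.sin (θ / 2) := by
    rw [Real.tan_eq_sin_div_cos, Real.sin_pi_div_two_sub, Real.cos_pi_div_two_sub]
    push_cast; rfl
  have hE0 := Complex.exp_ne_zero ((θ : ℂ) * Complex.I)
  rw [htan, hexp]
  rw [hexp] at hE0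
  generalize (Real.sin (θ / 2) : ℂ) = S at *
  generalize (Real.cos (θ / 2) : ℂ) = C at *
  have hI : Complex.I ^ 2 = -1 := Complex.I_sq
  have hCS : C + S * Complex.I ≠ 0 := by
    intro h; rw [h] at hE0; simp at hE0
  have hden : 1 - (C + S * Complex.I) ^ 2 = -2 * Complex.I * S * (C + S * Complex.I) := by
    linear_combination -hsq + S ^ 2 * hI
  have hden0 : 1 - (C + S * Complex.I) ^ 2 ≠ 0 := by
    rw [hden]; simp [hs0, hCS]
  refine ⟨fun h => hden0 (by rw [h]; ring), ?_, ?_⟩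
  · rw [eq_div_iff hden0, hden]
    field_simp
    linear_combination hsq + (-2 * C ^ 2 - 2 * C * S * Complex.I - S^2) * hI
  · field_simp
    linear_combination (C ^ 2 + S ^ 2) * hI

lemma ofReal_pos_mul_cpow (c : ℂ) {r : ℝ} (hr : 0 < r) (z : ℂ) (hz : z ≠ 0) :
    ((r : ℂ) * z) ^ c = (r : ℂ) ^ c * z ^ c := by
  have hr0 : (r : ℂ) ≠ 0 := by exact_mod_cast hr.ne'
  rw [Complex.cpow_def_of_ne_zero (mul_ne_zero hr0 hz), Complex.cpow_def_of_ne_zero hr0,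
    Complex.cpow_def_of_ne_zero hz, Complex.log_ofReal_mul hr hz, ← Complex.exp_add,
    Complex.ofReal_log hr.le]
  ring_nf

lemma stableCF_eq_s3 (a σ : ℝ) (ha : 0 < a) (ha1 : a < 1)
    (hσ : σ ^ a = Real.cos (a * Real.pi / 2)) (y : ℝ) :
    stableCF a 1 σ 0 (-y) = Complex.exp (-(((y : ℂ) * Complex.I) ^ (a : ℂ))) := by
  have hc : 0 < Real.cos (a * Real.pi / 2) := by
    apply Real.cos_pos_of_mem_Ioo
    constructor <;> nlinarith [Real.pi_pos]
  have hc0 : Real.cos (a * Real.pi / 2) ≠ 0 := hc.ne'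
  have ht : Real.cos (a * Real.pi / 2) * Real.tan (a * Real.pi / 2) = Real.sin (a * Real.pi / 2) :=
    by rw [mul_comm]; exact Real.tan_mul_cos hc0
  have ht' : (Real.cos (a * Real.pi / 2) : ℂ) * (Real.tan (a * Real.pi / 2) : ℝ)
      = (Real.sin (a * Real.pi / 2) : ℝ) := by exact_mod_cast ht
  unfold stableCF
  rw [hσ]
  congr 1
  rcases lt_trichotomy y 0 with hy | hy | hy
  · have h1 : (y : ℂ) * Complex.I = ((-y : ℝ) : ℂ) * (-Complex.I) := by push_cast; ring
    have h2 : (-Complex.I) ^ (a : ℂ) = (Real.cos (a * Real.pi / 2) : ℂ)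
        - (Real.sin (a * Real.pi / 2) : ℂ) * Complex.I := by
      rw [Complex.cpow_def_of_ne_zero (by simp), Complex.log_neg_I]
      rw [show -(Real.pi / 2 : ℂ) * Complex.I * a = ((-(a * Real.pi / 2) : ℝ) : ℂ) * Complex.I by
        push_cast; ring, Complex.exp_mul_I, ← Complex.ofReal_cos, ← Complex.ofReal_sin,
        Real.cos_neg, Real.sin_neg]
      push_cast; ring
    rw [h1, ofReal_pos_mul_cpow _ (show 0 < -y by linarith) _ (by simp), h2, Real.sign_of_pos (by linarith),
      abs_of_pos (by linarith), ← Complex.ofReal_cpow (by linarith)]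
    push_cast at ht' ⊢
    linear_combination (((-y) ^ a : ℝ) : ℂ) * Complex.I * ht'
  · subst hy
    have : (a : ℂ) ≠ 0 := by exact_mod_cast ha.ne'
    simp [this, Real.zero_rpow ha.ne']
  · have h2 : (Complex.I) ^ (a : ℂ) = (Real.cos (a * Real.pi / 2) : ℂ)
        + (Real.sin (a * Real.pi / 2) : ℂ) * Complex.I := by
      rw [Complex.cpow_def_of_ne_zero (by simp), Complex.log_I]
      rw [show (Real.pi / 2 : ℂ) * Complex.I * a = ((a * Real.pi / 2 : ℝ) : ℂ) * Complex.I by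
        push_cast; ring, Complex.exp_mul_I, ← Complex.ofReal_cos, ← Complex.ofReal_sin]
    rw [ofReal_pos_mul_cpow _ hy _ (by simp), h2, Real.sign_of_neg (by linarith), abs_neg,
      abs_of_pos hy, ← Complex.ofReal_cpow hy.le]
    push_cast at ht' ⊢
    linear_combination -((y ^ a : ℝ) : ℂ) * Complex.I * ht'

lemma laplace_stable (a σ l : ℝ) (ha : 0 < a) (ha1 : a < 1) (hl : 0 < l)
    (hσ : σ ^ a = Real.cos (a * Real.pi / 2)) (g : ℝ → ℝ) (hg : IsStableDensity a 1 σ 0 g) :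
    ∫ u in Ioi (0:ℝ), u * Real.exp (-(l * u)) * g u = a * l ^ (a - 1) * Real.exp (-(l ^ a)) := by
  obtain ⟨-, hint, hcf⟩ := hg
  have hpi : (Real.pi : ℂ) ≠ 0 := by exact_mod_cast Real.pi_ne_zero
  have hl0 : (l : ℂ) ≠ 0 := by exact_mod_cast hl.ne'
  have hF : ∀ w : ℝ, 𝓕 (fun u => (g u : ℂ)) w =
      Complex.exp (-((((2 * Real.pi * w : ℝ) : ℂ) * Complex.I) ^ (a : ℂ))) := by
    intro w
    rw [← stableCF_eq_s3 a σ ha ha1 hσ, ← hcf, Real.fourier_real_eq_integral_exp_smul]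
    congr 1; ext u
    rw [smul_eq_mul]
    congr 2
    push_cast; ring
  have h1 := lapF_duality l hl (fun u => (g u : ℂ)) hint.ofReal
  rw [line_to_circle l hl (fun w : ℝ => 1 / ((l : ℂ) - 2 * Real.pi * w * Complex.I) ^ 2 * _)] at h1
  have h2 : ∫ θ in Ioo 0 (2 * Real.pi), (l / (4 * Real.pi * Real.sin (θ / 2) ^ 2)) •
      (1 / ((l : ℂ) - 2 * Real.pi * (l / (2 * Real.pi) * Real.tan (Real.pi / 2 - θ / 2) : ℝ)
        * Complex.I) ^ 2 *
        𝓕 (fun u => (g u : ℂ)) (l / (2 * Real.pi) * Real.tan (Real.pi / 2 - θ / 2)))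
      = ∫ θ in Ioo 0 (2 * Real.pi), (-1 / (4 * Real.pi * l) : ℂ) * (Complex.exp (-(θ * Complex.I)) *
      discF a l (Complex.exp (θ * Complex.I))) := by
    apply setIntegral_congr_fun measurableSet_Ioo
    intro θ hθ
    obtain ⟨e1, e2, e3⟩ := tan_cayley θ hθ
    have hs : 0 < Real.sin (θ / 2) :=
      Real.sin_pos_of_pos_of_lt_pi (by linarith [hθ.1]) (by linarith [hθ.2])
    have hs0 : (Real.sin (θ / 2) : ℂ) ≠ 0 := by exact_mod_cast hs.ne'
    have hr : 2 * Real.pi * (l / (2 * Real.pi) * Real.tan (Real.pi / 2 - θ / 2))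
        = l * Real.tan (Real.pi / 2 - θ / 2) := by
      have := Real.pi_ne_zero
      field_simp
    have hD : discF a l (Complex.exp (θ * Complex.I)) =
        𝓕 (fun u => (g u : ℂ)) (l / (2 * Real.pi) * Real.tan (Real.pi / 2 - θ / 2)) := by
      rw [hF, hr, discF, if_neg e1, ← e2]
      push_cast
      ring_nf
    have hr' : (2 * Real.pi : ℂ) * (l / (2 * Real.pi) * Real.tan (Real.pi / 2 - θ / 2) : ℝ)
        = l * (Real.tan (Real.pi / 2 - θ / 2) : ℝ) := by exact_mod_cast hr
    simp only [hr']
    rw [hD]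
    generalize 𝓕 (fun u => (g u : ℂ)) (l / (2 * Real.pi) * Real.tan (Real.pi / 2 - θ / 2)) = X
    generalize ((Real.tan (Real.pi / 2 - θ / 2) : ℝ) : ℂ) = T at *
    rw [Complex.real_smul, Complex.exp_neg]
    have hE0 := Complex.exp_ne_zero ((θ : ℂ) * Complex.I)
    generalize Complex.exp ((θ : ℂ) * Complex.I) = E at *
    push_cast at hs0 e3 ⊢
    generalize Complex.sin ((θ : ℂ) / 2) = S at *
    have hT : 1 - T * Complex.I ≠ 0 := by
      intro h; rw [h] at e3; apply hE0; linear_combination e3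
    rw [show (l : ℂ) - l * T * Complex.I = l * (1 - T * Complex.I) by ring]
    have hE : E = -((1 - T * Complex.I) ^ 2 * S ^ 2) := by linear_combination e3
    rw [hE]
    field_simp
  rw [h2, integral_const_mul, disc_cauchy a l ha ha1 hl] at h1
  have h3 : ((∫ u in Ioi (0:ℝ), u * Real.exp (-(l * u)) * g u : ℝ) : ℂ) =
      ∫ u, lapF l u * (g u : ℂ) := by
    rw [← integral_complex_ofReal, ← integral_indicator measurableSet_Ioi]
    congr 1; ext u
    rw [lapF_indicator]
    by_cases hu : 0 < u
    · simp [hu]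
    · simp [hu]
  rw [h1] at h3
  have h4 : (-1 / (4 * Real.pi * l) : ℂ) *
      (2 * Real.pi * ((-(2 * a * l ^ a * Real.exp (-(l ^ a))) : ℝ) : ℂ)) =
      ((a * l ^ (a - 1) * Real.exp (-(l ^ a)) : ℝ) : ℂ) := by
    rw [Real.rpow_sub hl, Real.rpow_one]
    push_cast
    field_simp
    norm_num
  rw [h4] at h3
  exact_mod_cast h3


/-- The Laplace transform in time of the inverse `1/α`-stable subordinator density
`h(x,t) = α t x^{−1−α} g(t x^{−α}; 1/α, 1, |cos(π/(2α))|^α, 0)` is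
`s^{−1+1/α} exp(−x s^{1/α})` for `x > 0`, `s > 0`. -/
theorem laplace_transform_inverse_stable_subordinator
    (α : ℝ) (hα : 1 < α ∧ α < 2)
    (g : ℝ → ℝ → ℝ → ℝ → ℝ → ℝ)
    (hg : ∀ a β σ v : ℝ, (0 < a ∧ a < 2 ∧ a ≠ 1) → (-1 ≤ β ∧ β ≤ 1) → 0 < σ →
      IsStableDensity a β σ v (fun x => g x a β σ v))
    (h : ℝ → ℝ → ℝ)
    (hh : ∀ x t : ℝ, h x t
      = α * t * x ^ (-1 - α) * g (t * x ^ (-α)) (1 / α) 1 (|Real.cos (Real.pi / (2 * α))| ^ α) 0)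
    (x s : ℝ) (hx : 0 < x) (hs : 0 < s) :
    ∫ t in Set.Ioi (0 : ℝ), Real.exp (-(s * t)) * h x t
      = s ^ (-1 + 1 / α) * Real.exp (-(x * s ^ (1 / α))) := by
  have hα0 : 0 < α := by linarith [hα.1]
  have ha : 0 < 1 / α := by positivity
  have ha1 : 1 / α < 1 := by rw [div_lt_one hα0]; exact hα.1
  have hang : Real.pi / (2 * α) = 1 / α * Real.pi / 2 := by field_simp
  have hc : 0 < Real.cos (1 / α * Real.pi / 2) := by
    apply Real.cos_pos_of_mem_Ioo
    constructor <;> nlinarith [Real.pi_pos]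
  have hσ0 : 0 < |Real.cos (Real.pi / (2 * α))| ^ α := by
    rw [hang, abs_of_pos hc]; positivity
  have hσ : (|Real.cos (Real.pi / (2 * α))| ^ α) ^ (1 / α) = Real.cos (1 / α * Real.pi / 2) := by
    rw [hang, abs_of_pos hc, ← Real.rpow_mul hc.le, mul_one_div_cancel hα0.ne', Real.rpow_one]
  have hden := hg (1 / α) 1 _ 0 ⟨ha, by linarith, by linarith⟩ ⟨by norm_num, le_rfl⟩ hσ0
  have hb : 0 < x ^ (-α) := Real.rpow_pos_of_pos hx _
  have hl : 0 < s * x ^ α := by positivity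
  have key := laplace_stable (1 / α) _ (s * x ^ α) ha ha1 hl hσ _ hden
  have hxx : x ^ α * x ^ (-α) = 1 := by rw [← Real.rpow_add hx]; simp
  have h5 := integral_comp_mul_right_Ioi (fun u => u * Real.exp (-(s * x ^ α * u)) *
    g u (1 / α) 1 (|Real.cos (Real.pi / (2 * α))| ^ α) 0) 0 hb
  rw [zero_mul, key, smul_eq_mul] at h5
  have h6 : ∀ t : ℝ, Real.exp (-(s * t)) * h x t = (α * x⁻¹) *
      (t * x ^ (-α) * Real.exp (-(s * x ^ α * (t * x ^ (-α)))) *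
        g (t * x ^ (-α)) (1 / α) 1 (|Real.cos (Real.pi / (2 * α))| ^ α) 0) := by
    intro t
    have e1 : s * x ^ α * (t * x ^ (-α)) = s * t := by linear_combination s * t * hxx
    have e2 : x ^ (-1 - α) = x⁻¹ * x ^ (-α) := by
      rw [sub_eq_add_neg, Real.rpow_add hx, Real.rpow_neg_one]
    rw [hh, e1, e2]; ring
  simp_rw [h6]
  rw [integral_const_mul, h5]
  have e3 : (s * x ^ α) ^ (1 / α) = x * s ^ (1 / α) := by
    rw [Real.mul_rpow hs.le (by positivity), ← Real.rpow_mul hx.le, mul_one_div_cancel hα0.ne',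
      Real.rpow_one, mul_comm]
  rw [Real.rpow_sub hl, Real.rpow_one, e3, Real.rpow_neg hx.le, inv_inv, neg_add_eq_sub,
    Real.rpow_sub hs, Real.rpow_one]
  have : 0 < x ^ α := by positivity
  field_simp
end
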